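/- arXiv:2206.10872 — 4 statements merged into one kernel-verified Lean document; each statement's English description precedes it below -/
import Mathlib

section
/- (1) For every faithful simple right S-module V there exists z ∈ S such that: z is irreducible in both S and T, and V ≅ S/zS ≅ T/zT as S-modules; moreover any element z of S with V ≅ S/zS ≅ T/zT is a type (B) irreducible. (2) Conversely, if z ∈ S is irreducible in both S and T and has type (B), then S/zS ≅ T/zT is a faithful simple right S-module. -/
open MulOpposite

universe u

/-- `φ : R →+* S` and `θ : S` exhibit `S` as the skew polynomial ring `R[θ; α]`:
`θ · r = α(r) · θ`, and every element of `S` is uniquely a polynomial `Σ rᵢ θ^i`. -/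
structure IsSkewPolynomialRing {R S : Type u} [CommRing R] [Ring S]
    (α : R ≃+* R) (φ : R →+* S) (θ : S) : Prop where
  commutes : ∀ r : R, θ * φ r = φ (α r) * θ
  bijective : Function.Bijective fun p : ℕ →₀ R => p.sum fun n r => φ r * θ ^ n

/-- `ψ : S →+* T` exhibits `T` as the (Ore) localization of `S` inverting the
powers of the normal element `x`. -/
structure IsLocalizationAt {S T : Type u} [Ring S] [Ring T] (x : S) (ψ : S →+* T) : Prop where
  inj : Function.Injective ψ
  unit : IsUnit (ψ x)
  surj : ∀ t : T, ∃ (s : S) (n : ℕ), t * ψ x ^ n = ψ s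

/-- The right ideal `zS`. -/
abbrev rSpan (S : Type u) [Ring S] (z : S) : Submodule Sᵐᵒᵖ S := Submodule.span Sᵐᵒᵖ {z}

/-- The left ideal `Sz`. -/
abbrev lSpan (S : Type u) [Ring S] (z : S) : Submodule S S := Submodule.span S {z}

/-- The cyclic right `S`-module `S/zS`. -/
abbrev rQuot (S : Type u) [Ring S] (z : S) : Type u := S ⧸ rSpan S z

/-- The cyclic left `S`-module `S/Sz`. -/
abbrev lQuot (S : Type u) [Ring S] (z : S) : Type u := S ⧸ lSpan S z

/-- The cyclic right `S`-module `S/(aS + bS)`. -/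
abbrev rQuot2 (S : Type u) [Ring S] (a b : S) : Type u := S ⧸ (rSpan S a ⊔ rSpan S b)

/-- Two elements of `T` are similar if `T/aT ≅ T/bT` as right `T`-modules. -/
def SimilarIn (T : Type u) [Ring T] (a b : T) : Prop :=
  Nonempty (rQuot T a ≃ₗ[Tᵐᵒᵖ] rQuot T b)

/-- The image in `S` of a polynomial `p ∈ k[θ]`, i.e. `Σ φ(pᵢ) θ^i`. -/
def thetaPoly {k R S : Type u} [CommSemiring k] [CommRing R] [Ring S] [Algebra k R]
    (φ : R →+* S) (θ : S) (p : Polynomial k) : S :=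
  p.sum fun n c => φ (algebraMap k R c) * θ ^ n

/-- Type (A) irreducibles of `S = R[θ; α]`: unit multiples of `X` or `θ`. -/
def IsTypeA {R S : Type u} [CommRing R] [Ring S] (X : R) (φ : R →+* S) (θ : S) (z : S) : Prop :=
  ∃ u : Sˣ, (u : S) * z = φ X ∨ (u : S) * z = θ

/-- Type (B) irreducibles of `S = R[θ; α]`: unit multiples of `1 + Xs`, `s ∈ S∖R`. -/
def IsTypeB {R S : Type u} [CommRing R] [Ring S] (X : R) (φ : R →+* S) (z : S) : Prop :=
  ∃ (u : Sˣ) (s : S), s ∉ Set.range φ ∧ (u : S) * z = 1 + φ X * s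

/-- Type (C) irreducibles of `S = R[θ; α]`: unit multiples of `f + Xs` with
`f ∈ k[θ]∖k` monic and the element not equal to `θ`. -/
def IsTypeC (k : Type u) {R S : Type u} [CommSemiring k] [CommRing R] [Ring S] [Algebra k R]
    (X : R) (φ : R →+* S) (θ : S) (z : S) : Prop :=
  ∃ (u : Sˣ) (p : Polynomial k) (s : S), p.Monic ∧ 1 ≤ p.natDegree ∧
    (u : S) * z = thetaPoly φ θ p + φ X * s ∧ (u : S) * z ≠ θ

/-- A module is locally Artinian if all its finitely generated submodules are Artinian. -/
def IsLocallyArtinian (A M : Type u) [Ring A] [AddCommGroup M] [Module A M] : Prop :=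
  ∀ N : Submodule A M, N.FG → IsArtinian A N

/-- A submodule is essential if it meets every nonzero submodule nontrivially. -/
def IsEssentialSubmodule {A : Type u} [Ring A] {E : Type u} [AddCommGroup E] [Module A E]
    (U : Submodule A E) : Prop :=
  ∀ W : Submodule A E, W ≠ ⊥ → W ⊓ U ≠ ⊥

/-- `f : V →ₗ[A] E` exhibits `E` as an injective hull of `V`. -/
def IsInjectiveHullVia (A : Type u) [Ring A] {V E : Type u} [AddCommGroup V] [Module A V]
    [AddCommGroup E] [Module A E] (f : V →ₗ[A] E) : Prop :=
  Module.Injective A E ∧ Function.Injective f ∧ IsEssentialSubmodule (LinearMap.range f)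

/-- Property (◊) for left `A`-modules: the injective hull of every simple left `A`-module
is locally Artinian.  (Apply with `A = Sᵐᵒᵖ` for the right-module version.) -/
def HasDiamond (A : Type u) [Ring A] : Prop :=
  ∀ (V E : Type u) [AddCommGroup V] [Module A V] [AddCommGroup E] [Module A E]
    (f : V →ₗ[A] E), IsSimpleModule A V → IsInjectiveHullVia A f → IsLocallyArtinian A E

/-- Gabriel–Rentschler Krull dimension at most `n`; the base case `n = 0` is
`Artinian`, and `Kdim M ≤ n + 1` iff in every descending chain of submodules almost
all successive factors have Krull dimension at most `n`. -/
def KdimLE (A : Type u) [Ring A] : ℕ → ∀ (M : Type u) [AddCommGroup M] [Module A M], Prop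
  | 0, M, _, _ => IsArtinian A M
  | n + 1, M, _, _ =>
      ∀ f : ℕ → Submodule A M, (∀ i, f (i + 1) ≤ f i) →
        ∃ N : ℕ, ∀ i, N ≤ i →
          KdimLE A n (↥(f i) ⧸ Submodule.comap (f i).subtype (f (i + 1)))

/-- A `1`-critical module: Krull dimension exactly `1`, and all proper factors of
Krull dimension `< 1`, i.e. Artinian. -/
def IsOneCritical (A : Type u) [Ring A] (M : Type u) [AddCommGroup M] [Module A M] : Prop :=
  KdimLE A 1 M ∧ ¬ IsArtinian A M ∧ ∀ N : Submodule A M, N ≠ ⊥ → IsArtinian A (M ⧸ N)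

/-- A right `S`-module is `𝒳`-torsion free (`𝒳 = {xⁿ}`). -/
def IsXTorsionFree {S : Type u} [Ring S] (x : S) (M : Type u) [AddCommGroup M]
    [Module Sᵐᵒᵖ M] : Prop :=
  ∀ (m : M) (n : ℕ), op (x ^ n) • m = 0 → m = 0

/-- A right `S`-module is `𝒳`-torsion (`𝒳 = {xⁿ}`). -/
def IsXTorsion {S : Type u} [Ring S] (x : S) (M : Type u) [AddCommGroup M]
    [Module Sᵐᵒᵖ M] : Prop :=
  ∀ m : M, ∃ n : ℕ, op (x ^ n) • m = 0

/-- The central embedding of `k` into `Sᵐᵒᵖ` coming from `k → R → S`. -/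
def opScalars {k R S : Type u} [CommSemiring k] [CommRing R] [Ring S] [Algebra k R]
    (φ : R →+* S) : k →+* Sᵐᵒᵖ where
  toFun c := op (φ (algebraMap k R c))
  map_one' := by simp
  map_mul' x y := by
    show op (φ (algebraMap k R (x * y))) = op (φ (algebraMap k R x)) * op (φ (algebraMap k R y))
    rw [mul_comm x y, map_mul, map_mul, op_mul]
  map_zero' := by simp
  map_add' x y := by
    show op (φ (algebraMap k R (x + y))) = op (φ (algebraMap k R x)) + op (φ (algebraMap k R y))
    rw [map_add, map_add, op_add]

/-- A right `S`-module is finite dimensional over the central subfield `k`. -/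
def FinDimOver (k : Type u) {R S : Type u} [Field k] [CommRing R] [Ring S] [Algebra k R]
    (φ : R →+* S) (M : Type u) [AddCommGroup M] [Module Sᵐᵒᵖ M] : Prop :=
  letI : Module k M := Module.compHom M (opScalars φ)
  Module.Finite k M

/-- A left `S`-module is finite dimensional over the central subfield `k`. -/
def FinDimOverLeft (k : Type u) {R S : Type u} [Field k] [CommRing R] [Ring S] [Algebra k R]
    (φ : R →+* S) (M : Type u) [AddCommGroup M] [Module S M] : Prop :=
  letI : Module k M := Module.compHom M (φ.comp (algebraMap k R))
  Module.Finite k M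

/-- `Ext¹_A(U, V) = 0`: every short exact sequence `0 → V → Y → U → 0` splits. -/
def ExtVanish (A : Type u) [Ring A] (U V : Type u) [AddCommGroup U] [Module A U]
    [AddCommGroup V] [Module A V] : Prop :=
  ∀ (Y : Type u) [AddCommGroup Y] [Module A Y] (i : V →ₗ[A] Y) (p : Y →ₗ[A] U),
    Function.Injective i → Function.Surjective p → LinearMap.range i = LinearMap.ker p →
    ∃ r : Y →ₗ[A] V, r.comp i = LinearMap.id

/-- The right `S`-module `V` is isomorphic, as an `S`-module, to the right `T`-module `Q`
(`T` an `S`-ring via `ψ`). -/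
def SModIsoOfT {S T : Type u} [Ring S] [Ring T] (ψ : S →+* T)
    (V : Type u) [AddCommGroup V] [Module Sᵐᵒᵖ V]
    (Q : Type u) [AddCommGroup Q] [Module Tᵐᵒᵖ Q] : Prop :=
  ∃ e : V ≃+ Q, ∀ (s : S) (v : V), e (op s • v) = op (ψ s) • e v

/-- Two modules are hull-similar: they contain nonzero isomorphic submodules
(equivalently, their injective hulls are isomorphic). -/
def HullSimilar (A : Type u) [Ring A] (M N : Type u) [AddCommGroup M] [Module A M]
    [AddCommGroup N] [Module A N] : Prop :=
  ∃ (P : Submodule A M) (Q : Submodule A N), P ≠ ⊥ ∧ Q ≠ ⊥ ∧ Nonempty (P ≃ₗ[A] Q)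

/-- Restriction of scalars along `ψ : S →+* T` for right modules. -/
def restrictOp {S T : Type u} [Ring S] [Ring T] (ψ : S →+* T)
    (E : Type u) [AddCommGroup E] [Module Tᵐᵒᵖ E] : Module Sᵐᵒᵖ E :=
  Module.compHom E (RingHom.op ψ)

/-- `f : V →+ E` exhibits `E` as an injective hull of the `A`-module `V`,
where `f` is additionally required to be `A`-linear. -/
def IsInjectiveHullViaAdd (A : Type u) [Ring A] {V E : Type u} [AddCommGroup V] [Module A V]
    [AddCommGroup E] [Module A E] (f : V →+ E) : Prop :=
  Module.Injective A E ∧ Function.Injective f ∧ (∀ (a : A) (v : V), f (a • v) = a • f v) ∧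
    ∀ W : Submodule A E, W ≠ ⊥ → ∃ x : E, x ≠ 0 ∧ x ∈ W ∧ x ∈ Set.range f

section Skew

variable {k : Type u} [Field k] {R : Type u} [CommRing R] [Algebra k R] {α : R ≃ₐ[k] R}
  {S : Type u} [Ring S] {φ : R →+* S} {θ : S}

/-- The coefficient equivalence. -/
noncomputable def skE (hS : IsSkewPolynomialRing α.toRingEquiv φ θ) : (ℕ →₀ R) ≃+ S :=
  AddEquiv.ofBijective
    (Finsupp.liftAddHom (fun n => (AddMonoidHom.mulRight (θ ^ n)).comp φ.toAddMonoidHom))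
    (by
      have h := hS.bijective
      have e : (fun p : ℕ →₀ R => p.sum fun n r => φ r * θ ^ n) =
        (Finsupp.liftAddHom
          (fun n => (AddMonoidHom.mulRight (θ ^ n)).comp φ.toAddMonoidHom) : (ℕ →₀ R) →+ S) := by
        funext p
        simp only [Finsupp.liftAddHom_apply]
        rfl
      rw [e] at h
      exact h)

theorem skE_single (hS : IsSkewPolynomialRing α.toRingEquiv φ θ) (n : ℕ) (r : R) :
    skE hS (Finsupp.single n r) = φ r * θ ^ n := by
  simp [skE]

/-- Coefficients. -/
noncomputable def cf (hS : IsSkewPolynomialRing α.toRingEquiv φ θ) : S ≃+ (ℕ →₀ R) := (skE hS).symm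

theorem cf_mono (hS : IsSkewPolynomialRing α.toRingEquiv φ θ) (n : ℕ) (r : R) :
    cf hS (φ r * θ ^ n) = Finsupp.single n r := by
  rw [cf, AddEquiv.symm_apply_eq, skE_single]

theorem sk_ind (hS : IsSkewPolynomialRing α.toRingEquiv φ θ) {P : S → Prop} (h0 : P 0)
    (hadd : ∀ x y, P x → P y → P (x + y)) (hm : ∀ r n, P (φ r * θ ^ n)) (s : S) : P s := by
  obtain ⟨p, rfl⟩ := (skE hS).surjective s
  induction p using Finsupp.induction_linear with
  | zero => simpa using h0
  | add f g hf hg => rw [map_add]; exact hadd _ _ hf hg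
  | single n r => rw [skE_single]; exact hm r n

theorem sk_sum (hS : IsSkewPolynomialRing α.toRingEquiv φ θ) (s : S) :
    s = ∑ i ∈ (cf hS s).support, φ (cf hS s i) * θ ^ i := by
  apply (cf hS).injective
  rw [map_sum]
  simp_rw [cf_mono]
  exact (Finsupp.sum_single (cf hS s)).symm

theorem theta_pow (hS : IsSkewPolynomialRing α.toRingEquiv φ θ) (n : ℕ) (r : R) :
    θ ^ n * φ r = φ ((α ^ n) r) * θ ^ n := by
  induction n generalizing r with
  | zero => simp
  | succ n ih =>
    have h := hS.commutes r
    have h2 : α.toRingEquiv r = α r := rfl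
    rw [h2] at h
    rw [pow_succ, mul_assoc, h, ← mul_assoc, ih, pow_succ, AlgEquiv.mul_apply, mul_assoc]

theorem cf_phi_mul (hS : IsSkewPolynomialRing α.toRingEquiv φ θ) (r : R) (x : S) (i : ℕ) :
    cf hS (φ r * x) i = r * cf hS x i := by
  induction x using sk_ind hS with
  | h0 => simp
  | hadd x y hx hy => simp [mul_add, hx, hy]
  | hm a n =>
    rw [← mul_assoc, ← map_mul, cf_mono, cf_mono, Finsupp.single_apply, Finsupp.single_apply]
    split_ifs <;> simp

theorem cf_mul_phi (hS : IsSkewPolynomialRing α.toRingEquiv φ θ) (r : R) (x : S) (i : ℕ) :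
    cf hS (x * φ r) i = cf hS x i * (α ^ i) r := by
  induction x using sk_ind hS with
  | h0 => simp
  | hadd x y hx hy => simp [add_mul, hx, hy]
  | hm a n =>
    rw [mul_assoc, theta_pow hS, ← mul_assoc, ← map_mul, cf_mono, cf_mono, Finsupp.single_apply,
      Finsupp.single_apply]
    split_ifs with h
    · rw [h]
    · simp

theorem cf_mul_theta (hS : IsSkewPolynomialRing α.toRingEquiv φ θ) (j : ℕ) (x : S) (i : ℕ) :
    cf hS (x * θ ^ j) i = if j ≤ i then cf hS x (i - j) else 0 := by
  induction x using sk_ind hS with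
  | h0 => simp
  | hadd x y hx hy =>
    rw [add_mul, map_add, map_add, Finsupp.add_apply, Finsupp.add_apply, hx, hy]
    split_ifs <;> simp
  | hm a n =>
    rw [mul_assoc, ← pow_add, cf_mono, cf_mono, Finsupp.single_apply, Finsupp.single_apply]
    split_ifs <;> first | rfl | omega

theorem cf_lead (hS : IsSkewPolynomialRing α.toRingEquiv φ θ) (x y : S) (n m : ℕ)
    (hx : ∀ i, n < i → cf hS x i = 0) (hy : ∀ i, m < i → cf hS y i = 0) :
    cf hS (x * y) (n + m) = cf hS x n * (α ^ n) (cf hS y m) := by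
  conv_lhs => rw [sk_sum hS y, Finset.mul_sum, map_sum, Finsupp.finsetSum_apply]
  simp_rw [← mul_assoc, cf_mul_theta, cf_mul_phi]
  rw [Finset.sum_eq_single m]
  · simp
  · intro i _ him
    split_ifs with h
    · rcases lt_or_gt_of_ne him with h1 | h1
      · rw [hx _ (by omega), zero_mul]
      · rw [hy _ h1, map_zero, mul_zero]
    · rfl
  · intro h
    simp [Finsupp.notMem_support_iff.mp h]

theorem exists_lead (hS : IsSkewPolynomialRing α.toRingEquiv φ θ) (x : S) (hx : x ≠ 0) :
    ∃ n, cf hS x n ≠ 0 ∧ ∀ i, n < i → cf hS x i = 0 := by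
  have h : (cf hS x).support.Nonempty := by
    rw [Finsupp.support_nonempty_iff]
    simpa using hx
  refine ⟨(cf hS x).support.max' h, ?_, ?_⟩
  · exact Finsupp.mem_support_iff.mp (Finset.max'_mem _ h)
  · intro i hi
    by_contra hc
    have := Finset.le_max' _ i (Finsupp.mem_support_iff.mpr hc)
    omega

theorem sk_noZeroDiv [IsDomain R] (hS : IsSkewPolynomialRing α.toRingEquiv φ θ) :
    NoZeroDivisors S := by
  constructor
  intro a b hab
  by_contra! h
  obtain ⟨n, hn, hn'⟩ := exists_lead hS a h.1
  obtain ⟨m, hm, hm'⟩ := exists_lead hS b h.2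
  have := cf_lead hS a b n m hn' hm'
  rw [hab] at this
  simp only [map_zero, Finsupp.zero_apply] at this
  rcases mul_eq_zero.mp this.symm with h | h
  · exact hn h
  · exact hm ((map_eq_zero_iff _ (α ^ n).injective).mp h)

theorem phi_inj (hS : IsSkewPolynomialRing α.toRingEquiv φ θ) : Function.Injective φ := by
  intro a b h
  have h1 := cf_mono hS 0 a
  rw [h, cf_mono] at h1
  exact (Finsupp.single_injective 0 h1).symm

end Skew

section Red

open Polynomial

variable {k : Type u} [Field k] {R : Type u} [CommRing R] [IsDomain R]
  [IsDiscreteValuationRing R] [Algebra k R] {α : R ≃ₐ[k] R}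
  {S : Type u} [Ring S] {φ : R →+* S} {θ : S} {X : R}

theorem mem_max_alpha (β : R ≃ₐ[k] R) (r : R) (h : r ∈ IsLocalRing.maximalIdeal R) :
    β r ∈ IsLocalRing.maximalIdeal R := by
  rw [IsLocalRing.mem_maximalIdeal, mem_nonunits_iff] at *
  intro h2
  apply h
  have := h2.map β.symm
  simpa using this

theorem res_alpha (hres : Function.Bijective ((IsLocalRing.residue R).comp (algebraMap k R)))
    (β : R ≃ₐ[k] R) (r : R) : IsLocalRing.residue R (β r) = IsLocalRing.residue R r := by
  obtain ⟨c, hc⟩ := hres.2 (IsLocalRing.residue R r)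
  have h1 : r - algebraMap k R c ∈ IsLocalRing.maximalIdeal R := by
    rw [← IsLocalRing.residue_eq_zero_iff, map_sub, ← hc]
    simp
  have h2 := mem_max_alpha β _ h1
  rw [← IsLocalRing.residue_eq_zero_iff, map_sub, map_sub, AlgEquiv.commutes] at h2
  rw [sub_eq_zero.mp h2, ← hc]
  rfl

/-- The additive reduction map. -/
noncomputable def redAdd (hS : IsSkewPolynomialRing α.toRingEquiv φ θ) :
    S →+ (IsLocalRing.ResidueField R)[X] :=
  (Finsupp.liftAddHom (fun n => (monomial n).toAddMonoidHom.comp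
    (IsLocalRing.residue R).toAddMonoidHom)).comp (cf hS).toAddMonoidHom

theorem redAdd_mono (hS : IsSkewPolynomialRing α.toRingEquiv φ θ) (r : R) (n : ℕ) :
    redAdd hS (φ r * θ ^ n) = monomial n (IsLocalRing.residue R r) := by
  simp [redAdd, cf_mono]

theorem redAdd_coeff (hS : IsSkewPolynomialRing α.toRingEquiv φ θ) (s : S) (i : ℕ) :
    (redAdd hS s).coeff i = IsLocalRing.residue R (cf hS s i) := by
  induction s using sk_ind hS with
  | h0 => simp
  | hadd x y hx hy => simp [hx, hy]
  | hm r n =>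
    rw [redAdd_mono, cf_mono, coeff_monomial, Finsupp.single_apply]
    split_ifs <;> simp

theorem redAdd_mul (hS : IsSkewPolynomialRing α.toRingEquiv φ θ)
    (hres : Function.Bijective ((IsLocalRing.residue R).comp (algebraMap k R))) (x y : S) :
    redAdd hS (x * y) = redAdd hS x * redAdd hS y := by
  induction x using sk_ind hS with
  | h0 => simp
  | hadd a b ha hb => simp [add_mul, ha, hb]
  | hm r n =>
    induction y using sk_ind hS with
    | h0 => simp
    | hadd a b ha hb => simp [mul_add, ha, hb]
    | hm r' m =>
      have : φ r * θ ^ n * (φ r' * θ ^ m) = φ (r * (α ^ n) r') * θ ^ (n + m) := by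
        rw [map_mul, pow_add, mul_assoc, ← mul_assoc (θ ^ n), theta_pow hS]
        simp only [mul_assoc]
      rw [this, redAdd_mono, redAdd_mono, redAdd_mono, map_mul, res_alpha hres,
        monomial_mul_monomial]

/-- Reduction modulo `X`. -/
noncomputable def red (hS : IsSkewPolynomialRing α.toRingEquiv φ θ)
    (hres : Function.Bijective ((IsLocalRing.residue R).comp (algebraMap k R))) :
    S →+* (IsLocalRing.ResidueField R)[X] :=
  { redAdd hS with
    map_one' := by
      have := redAdd_mono hS 1 0
      simpa using this
    map_mul' := redAdd_mul hS hres }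

theorem red_phi (hS : IsSkewPolynomialRing α.toRingEquiv φ θ)
    (hres : Function.Bijective ((IsLocalRing.residue R).comp (algebraMap k R))) (r : R) :
    red hS hres (φ r) = C (IsLocalRing.residue R r) := by
  have := redAdd_mono hS r 0
  rw [pow_zero, mul_one, monomial_zero_left] at this
  exact this

theorem red_ker (hX : IsLocalRing.maximalIdeal R = Ideal.span {X})
    (hS : IsSkewPolynomialRing α.toRingEquiv φ θ)
    (hres : Function.Bijective ((IsLocalRing.residue R).comp (algebraMap k R))) (s : S)
    (h : red hS hres s = 0) : (∃ t, s = φ X * t) ∧ (∃ t, s = t * φ X) := by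
  have hc : ∀ i, cf hS s i ∈ IsLocalRing.maximalIdeal R := by
    intro i
    rw [← IsLocalRing.residue_eq_zero_iff, ← redAdd_coeff]
    have : redAdd hS s = 0 := h
    rw [this, coeff_zero]
  constructor
  · have : s ∈ (AddMonoidHom.mulLeft (φ X)).range := by
      rw [sk_sum hS s]
      apply AddSubgroup.sum_mem
      intro i _
      have := hc i
      rw [hX, Ideal.mem_span_singleton'] at this
      obtain ⟨a, ha⟩ := this
      refine ⟨φ a * θ ^ i, ?_⟩
      rw [← ha, mul_comm a X, RingHom.map_mul φ]
      simp [mul_assoc]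
    obtain ⟨t, ht⟩ := this
    exact ⟨t, ht.symm⟩
  · have : s ∈ (AddMonoidHom.mulRight (φ X)).range := by
      rw [sk_sum hS s]
      apply AddSubgroup.sum_mem
      intro i _
      have := mem_max_alpha (α ^ i).symm _ (hc i)
      rw [hX, Ideal.mem_span_singleton'] at this
      obtain ⟨a, ha⟩ := this
      refine ⟨φ ((α ^ i) a) * θ ^ i, ?_⟩
      have h2 : cf hS s i = (α ^ i) a * (α ^ i) X := by
        rw [← map_mul, ha, AlgEquiv.apply_symm_apply]
      rw [h2, RingHom.map_mul φ]
      simp only [AddMonoidHom.mulRight_apply]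
      rw [mul_assoc, theta_pow hS, mul_assoc]
    obtain ⟨t, ht⟩ := this
    exact ⟨t, ht.symm⟩

theorem red_X (hX : IsLocalRing.maximalIdeal R = Ideal.span {X})
    (hS : IsSkewPolynomialRing α.toRingEquiv φ θ)
    (hres : Function.Bijective ((IsLocalRing.residue R).comp (algebraMap k R))) :
    red hS hres (φ X) = 0 := by
  rw [red_phi, (IsLocalRing.residue_eq_zero_iff X).mpr, C_0]
  rw [hX]; exact Ideal.mem_span_singleton_self X

theorem X_irr (hX : IsLocalRing.maximalIdeal R = Ideal.span {X}) : Irreducible X :=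
  (IsDiscreteValuationRing.irreducible_iff_uniformizer X).mpr hX

theorem phiX_ne (hX : IsLocalRing.maximalIdeal R = Ideal.span {X})
    (hS : IsSkewPolynomialRing α.toRingEquiv φ θ) : φ X ≠ 0 := by
  intro h
  exact (X_irr hX).ne_zero (phi_inj hS (by simpa using h))

theorem X_normal (hX : IsLocalRing.maximalIdeal R = Ideal.span {X})
    (hS : IsSkewPolynomialRing α.toRingEquiv φ θ)
    (hres : Function.Bijective ((IsLocalRing.residue R).comp (algebraMap k R))) (n : ℕ) (s : S) :
    (∃ t, φ X ^ n * s = t * φ X ^ n) ∧ (∃ t, s * φ X ^ n = φ X ^ n * t) := by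
  induction n generalizing s with
  | zero => exact ⟨⟨s, by simp⟩, ⟨s, by simp⟩⟩
  | succ n ih =>
    constructor
    · obtain ⟨t, ht⟩ := (ih s).1
      obtain ⟨t', ht'⟩ := (red_ker hX hS hres (φ X * t) (by simp [red_X hX hS hres])).2
      refine ⟨t', ?_⟩
      rw [pow_succ', mul_assoc, ht, ← mul_assoc, ht', mul_assoc]
    · obtain ⟨t, ht⟩ := (ih s).2
      obtain ⟨t', ht'⟩ := (red_ker hX hS hres (t * φ X) (by simp [red_X hX hS hres])).1
      refine ⟨t', ?_⟩
      rw [pow_succ, ← mul_assoc, ht, mul_assoc, ht', mul_assoc]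

theorem X_cancel (hX : IsLocalRing.maximalIdeal R = Ideal.span {X})
    (hS : IsSkewPolynomialRing α.toRingEquiv φ θ)
    (hres : Function.Bijective ((IsLocalRing.residue R).comp (algebraMap k R))) (z : S)
    (hz : red hS hres z ≠ 0) (n : ℕ) (a b : S) (h : a * φ X ^ n = z * b) : ∃ c, a = z * c := by
  have := sk_noZeroDiv hS
  induction n generalizing b with
  | zero => exact ⟨b, by simpa using h⟩
  | succ n ih =>
    have h1 : red hS hres b = 0 := by
      have h2 := congrArg (red hS hres) h
      rw [pow_succ, ← mul_assoc, map_mul, red_X hX hS hres, mul_zero, map_mul] at h2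
      exact (mul_eq_zero.mp h2.symm).resolve_left hz
    obtain ⟨t, rfl⟩ := (red_ker hX hS hres b h1).2
    refine ih t ?_
    rw [pow_succ, ← mul_assoc, ← mul_assoc] at h
    exact mul_right_cancel₀ (phiX_ne hX hS) h

theorem mem_rSpan {S : Type u} [Ring S] (z a : S) : a ∈ rSpan S z ↔ ∃ b, a = z * b := by
  rw [Submodule.mem_span_singleton]
  constructor
  · rintro ⟨c, rfl⟩; exact ⟨c.unop, rfl⟩
  · rintro ⟨b, rfl⟩; exact ⟨op b, rfl⟩

theorem mul_mem_R {S : Type u} [Ring S] (I : Submodule Sᵐᵒᵖ S) {a : S} (h : a ∈ I) (b : S) :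
    a * b ∈ I := I.smul_mem (op b) h

theorem principal (hX : IsLocalRing.maximalIdeal R = Ideal.span {X})
    (hS : IsSkewPolynomialRing α.toRingEquiv φ θ)
    (hres : Function.Bijective ((IsLocalRing.residue R).comp (algebraMap k R)))
    (I : Submodule Sᵐᵒᵖ S) (hI : I ≠ ⊥) (hcl : ∀ a, a * φ X ∈ I → a ∈ I) :
    ∃ z, I = rSpan S z ∧ red hS hres z ≠ 0 := by
  classical
  have hE : ∃ d, ∃ x ∈ I, x ≠ 0 ∧ ∀ i, d < i → cf hS x i = 0 := by
    obtain ⟨x, hx, hx0⟩ := I.ne_bot_iff.mp hI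
    obtain ⟨d, _, hd⟩ := exists_lead hS x hx0
    exact ⟨d, x, hx, hx0, hd⟩
  set d := Nat.find hE with hd
  obtain ⟨x, hxI, hx0, hxd⟩ := Nat.find_spec hE
  have hmin : ∀ m, ∀ x ∈ I, x ≠ 0 → (∀ i, m < i → cf hS x i = 0) → d ≤ m := fun m x h1 h2 h3 =>
    Nat.find_min' hE ⟨x, h1, h2, h3⟩
  rw [← hd] at hxd
  have hxc : cf hS x d ≠ 0 := by
    intro h0
    obtain ⟨m, hm, hm'⟩ := exists_lead hS x hx0
    have h1 := hmin m x hxI hx0 hm'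
    rcases h1.eq_or_lt with h | h
    · exact hm (h ▸ h0)
    · exact hm (hxd _ h)
  have hirr := X_irr hX
  have hE2 : ∃ v, ∃ x ∈ I, (∀ i, d < i → cf hS x i = 0) ∧ ¬ X ^ v ∣ cf hS x d := by
    obtain ⟨n, u, hu⟩ := IsDiscreteValuationRing.eq_unit_mul_pow_irreducible hxc hirr
    refine ⟨n + 1, x, hxI, hxd, ?_⟩
    rw [hu, Units.dvd_mul_left, pow_dvd_pow_iff hirr.ne_zero hirr.not_isUnit]
    omega
  obtain ⟨z, hzI, hzd, hzv⟩ := Nat.find_spec hE2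
  have hzc : cf hS z d ≠ 0 := fun h => hzv (by rw [h]; exact dvd_zero _)
  have hred : red hS hres z ≠ 0 := by
    intro h
    obtain ⟨t, rfl⟩ := (red_ker hX hS hres z h).2
    have htI := hcl t hzI
    obtain ⟨w, hw⟩ : ∃ w, Nat.find hE2 = w + 1 := by
      apply Nat.exists_eq_succ_of_ne_zero
      intro h0
      rw [h0] at hzv
      simp at hzv
    have hαX : ∀ i : ℕ, X ∣ (α ^ i) X := by
      intro i
      rw [← Ideal.mem_span_singleton, ← hX]
      apply mem_max_alpha
      rw [hX]; exact Ideal.mem_span_singleton_self X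
    refine Nat.find_min hE2 (m := w) (by omega) ⟨t, htI, ?_, ?_⟩
    · intro i hi
      have := hzd i hi
      rw [cf_mul_phi] at this
      refine (mul_eq_zero.mp this).resolve_right ?_
      exact fun h => hirr.ne_zero ((map_eq_zero_iff _ (α ^ i).injective).mp h)
    · intro hdv
      apply hzv
      rw [hw, cf_mul_phi, pow_succ]
      exact mul_dvd_mul hdv (hαX d)
  have key : ∀ n, ∀ a ∈ I, (∀ i, n ≤ i → cf hS a i = 0) → ∃ c b, c ≠ 0 ∧ a * φ c = z * b := by
    intro n
    induction n with
    | zero =>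
      intro a _ ha
      have : a = 0 := by
        apply (cf hS).injective
        ext i
        simp [ha i]
      exact ⟨1, 0, one_ne_zero, by simp [this]⟩
    | succ m ih =>
      intro a haI ha
      by_cases h0 : cf hS a m = 0
      · refine ih a haI fun i hi => ?_
        rcases hi.eq_or_lt with rfl | h
        · exact h0
        · exact ha i h
      · have ha0 : a ≠ 0 := by rintro rfl; simp at h0
        have hdm := hmin m a haI ha0 (fun i hi => ha i hi)
        set c := (α ^ m).symm (cf hS z d) with hc
        set b := (α ^ d).symm (cf hS a m) with hb
        have hc0 : c ≠ 0 := by simpa [hc] using hzc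
        obtain ⟨c', b', hc', h'⟩ := ih (a * φ c - z * φ b * θ ^ (m - d))
          (I.sub_mem (mul_mem_R I haI _) (mul_mem_R I (mul_mem_R I hzI _) _)) (by
            intro i hi
            rw [map_sub, Finsupp.sub_apply, cf_mul_phi, cf_mul_theta, if_pos (by omega), cf_mul_phi]
            rcases hi.eq_or_lt with rfl | h
            · rw [show m - (m - d) = d by omega, hc, hb, AlgEquiv.apply_symm_apply,
                AlgEquiv.apply_symm_apply, mul_comm, sub_self]
            · rw [ha i h, hzd _ (by omega)]; simp)
        refine ⟨c * c', φ b * θ ^ (m - d) * φ c' + b', mul_ne_zero hc0 hc', ?_⟩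
        rw [mul_add, ← h', map_mul]
        noncomm_ring
  refine ⟨z, le_antisymm ?_ ?_, hred⟩
  · intro a ha
    rw [mem_rSpan]
    have : ∃ n, ∀ i, n ≤ i → cf hS a i = 0 := by
      by_cases h0 : a = 0
      · exact ⟨0, by simp [h0]⟩
      · obtain ⟨n, _, hn⟩ := exists_lead hS a h0
        exact ⟨n + 1, hn⟩
    obtain ⟨n, hn⟩ := this
    obtain ⟨c, b, hc, h⟩ := key n a ha hn
    obtain ⟨v, u, rfl⟩ := IsDiscreteValuationRing.eq_unit_mul_pow_irreducible hc hirr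
    refine X_cancel hX hS hres z hred v a (b * φ ↑u⁻¹) ?_
    rw [← mul_assoc, ← h, mul_assoc, ← map_mul, ← map_pow]
    congr 2
    rw [mul_right_comm]; simp
  · rw [Submodule.span_le, Set.singleton_subset_iff]; exact hzI

end Red

section Modules

theorem simple_gen {S : Type u} [Ring S] {V : Type u} [AddCommGroup V] [Module Sᵐᵒᵖ V]
    (h : IsSimpleModule Sᵐᵒᵖ V) {v : V} (hv : v ≠ 0) (w : V) : ∃ s : S, op s • v = w := by
  obtain ⟨c, hc⟩ := IsSimpleModule.toSpanSingleton_surjective Sᵐᵒᵖ hv w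
  exact ⟨c.unop, by simpa using hc⟩

theorem simple_of_gen {S : Type u} [Ring S] {V : Type u} [AddCommGroup V] [Module Sᵐᵒᵖ V]
    (h0 : Nontrivial V) (h : ∀ v : V, v ≠ 0 → ∀ w, ∃ s : S, op s • v = w) :
    IsSimpleModule Sᵐᵒᵖ V := by
  rw [isSimpleModule_iff_toSpanSingleton_surjective]
  refine ⟨h0, fun v hv w => ?_⟩
  obtain ⟨s, hs⟩ := h v hv w
  exact ⟨op s, by simpa using hs⟩

theorem irr_of_simple {S : Type u} [Ring S] [NoZeroDivisors S] (z : S) (hz : z ≠ 0)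
    (h : IsSimpleModule Sᵐᵒᵖ (rQuot S z)) : Irreducible z := by
  have hnt : Nontrivial S := ⟨z, 0, hz⟩
  have : IsDomain S := NoZeroDivisors.to_isDomain S
  have hco : IsCoatom (rSpan S z) := isSimpleModule_iff_isCoatom.mp h
  have unit_of : ∀ a b : S, a * b = 1 → IsUnit a := by
    intro a b hab
    have hb : b ≠ 0 := by rintro rfl; simp at hab
    have : b * a = 1 := by
      apply mul_right_cancel₀ hb
      rw [mul_assoc, hab, one_mul, mul_one]
    exact ⟨⟨a, b, hab, this⟩, rfl⟩
  refine ⟨?_, ?_⟩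
  · rintro ⟨u, rfl⟩
    apply hco.1
    rw [eq_top_iff]
    intro x _
    rw [mem_rSpan]
    exact ⟨↑u⁻¹ * x, by simp⟩
  · intro a b hab
    have hle : rSpan S z ≤ rSpan S a := by
      rw [Submodule.span_le, Set.singleton_subset_iff]
      exact (mem_rSpan a z).mpr ⟨b, hab⟩
    rcases hle.eq_or_lt with h1 | h1
    · right
      have : a ∈ rSpan S z := by rw [h1]; exact Submodule.mem_span_singleton_self a
      obtain ⟨c, hc⟩ := (mem_rSpan z a).mp this
      have ha : a ≠ 0 := by rintro rfl; simp at hab; exact hz hab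
      apply unit_of b c
      apply mul_left_cancel₀ ha
      rw [← mul_assoc, ← hab, ← hc, mul_one]
    · left
      have h2 := hco.2 _ h1
      have : (1 : S) ∈ rSpan S a := by rw [h2]; trivial
      obtain ⟨c, hc⟩ := (mem_rSpan a 1).mp this
      exact unit_of a c hc.symm

theorem T_noZeroDiv {S T : Type u} [Ring S] [Ring T] [NoZeroDivisors S] (x : S)
    (hn : ∀ (n : ℕ) (s : S), ∃ t, x ^ n * s = t * x ^ n)
    (ψ : S →+* T) (hT : IsLocalizationAt x ψ) : NoZeroDivisors T := by
  constructor
  intro a b hab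
  obtain ⟨s, n, hs⟩ := hT.surj a
  obtain ⟨t, m, ht⟩ := hT.surj b
  obtain ⟨t', ht'⟩ := hn n t
  have hu : ∀ n : ℕ, IsUnit (ψ x ^ n) := fun n => hT.unit.pow n
  obtain ⟨u, huu⟩ := hu n
  -- `a * b = 0` gives `a xⁿ · (x⁻ⁿ b) = 0`
  have h1 : ψ t = ψ x ^ n * (↑u⁻¹ * ψ t) := by rw [← huu]; simp
  by_cases hb : b = 0
  · exact Or.inr hb
  left
  -- choose a common form for `u⁻¹ b`
  obtain ⟨w, l, hw⟩ := hT.surj (↑u⁻¹ * b)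
  have h2 : ψ (s * w) = 0 := by
    rw [map_mul, ← hs, ← hw, ← huu]
    rw [show a * (u : T) * (↑u⁻¹ * b * ψ x ^ l) = a * ((u : T) * ↑u⁻¹) * b * ψ x ^ l by
      simp only [mul_assoc]]
    simp [hab]
  have h3 : s * w = 0 := hT.inj (by simpa using h2)
  rcases mul_eq_zero.mp h3 with h | h
  · rw [h, map_zero] at hs
    exact (hu n).mul_left_eq_zero.mp hs
  · rw [h, map_zero] at hw
    have := (hu l).mul_left_eq_zero.mp hw
    rw [Units.mul_right_eq_zero] at this
    exact absurd this hb

end Modules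

section Main

variable {k : Type u} [Field k] {R : Type u} [CommRing R] [IsDomain R]
  [IsDiscreteValuationRing R] [Algebra k R] {α : R ≃ₐ[k] R}
  {S : Type u} [Ring S] {φ : R →+* S} {θ : S} {X : R} {T : Type u} [Ring T] {ψ : S →+* T}

theorem X_div (hX : IsLocalRing.maximalIdeal R = Ideal.span {X})
    (hS : IsSkewPolynomialRing α.toRingEquiv φ θ)
    (hres : Function.Bijective ((IsLocalRing.residue R).comp (algebraMap k R))) (z c : S)
    (hz : red hS hres (z * c) = 1) (n : ℕ) (a : S) : ∃ b d, a = b * φ X ^ n + z * d := by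
  induction n with
  | zero => exact ⟨a, 0, by simp⟩
  | succ n ih =>
    obtain ⟨b, d, h⟩ := ih
    obtain ⟨t, ht⟩ := (red_ker hX hS hres (b - z * c * b) (by rw [map_sub, map_mul _ (z * c), hz]; simp)).2
    obtain ⟨t', ht'⟩ := (X_normal hX hS hres n (1 : S)).1
    refine ⟨t, c * b * φ X ^ n + d, ?_⟩
    have hb : b = t * φ X + z * c * b := by rw [← ht]; abel
    rw [h]
    conv_lhs => rw [hb]
    rw [pow_succ']
    noncomm_ring

theorem iso_T (hX : IsLocalRing.maximalIdeal R = Ideal.span {X})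
    (hS : IsSkewPolynomialRing α.toRingEquiv φ θ)
    (hres : Function.Bijective ((IsLocalRing.residue R).comp (algebraMap k R)))
    (hT : IsLocalizationAt (φ X) ψ) (z c : S)
    (hz : red hS hres (z * c) = 1) : SModIsoOfT ψ (rQuot S z) (rQuot T (ψ z)) := by
  have hz0 : red hS hres z ≠ 0 := by
    intro h; rw [map_mul, h, zero_mul] at hz; exact zero_ne_one hz
  let f : S →ₛₗ[RingHom.op ψ] T :=
    { toFun := ψ
      map_add' := map_add ψ
      map_smul' := fun m x => by
        show ψ (x * m.unop) = ψ x * ψ m.unop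
        exact map_mul ψ _ _ }
  have hle : rSpan S z ≤ (rSpan T (ψ z)).comap f := by
    rw [Submodule.span_le, Set.singleton_subset_iff]
    exact Submodule.mem_span_singleton_self (ψ z)
  let g := Submodule.mapQ (rSpan S z) (rSpan T (ψ z)) f hle
  have hg : Function.Bijective g := by
    constructor
    · rw [injective_iff_map_eq_zero]
      intro x hx
      obtain ⟨s, rfl⟩ := Submodule.mkQ_surjective _ x
      have h1 : ψ s ∈ rSpan T (ψ z) := by
        rw [Submodule.mkQ_apply, Submodule.mapQ_apply, Submodule.Quotient.mk_eq_zero] at hx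
        exact hx
      obtain ⟨t, ht⟩ := (mem_rSpan _ _).mp h1
      obtain ⟨w, n, hw⟩ := hT.surj t
      have h2 : s * φ X ^ n = z * w := by
        apply hT.inj
        rw [map_mul, map_mul, map_pow, ← hw, ht, mul_assoc]
      rw [Submodule.mkQ_apply, Submodule.Quotient.mk_eq_zero, mem_rSpan]
      exact X_cancel hX hS hres z hz0 n s w h2
    · intro y
      obtain ⟨t, rfl⟩ := Submodule.mkQ_surjective _ y
      obtain ⟨w, n, hw⟩ := hT.surj t
      obtain ⟨b, d, h⟩ := X_div hX hS hres z c hz n w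
      obtain ⟨u, hu⟩ := hT.unit.pow n
      refine ⟨Submodule.Quotient.mk b, ?_⟩
      rw [Submodule.mapQ_apply, Submodule.mkQ_apply, Submodule.Quotient.eq, mem_rSpan]
      refine ⟨-(ψ d * ↑u⁻¹), ?_⟩
      show ψ b - t = _
      have h1 : t = ψ w * ↑u⁻¹ := by rw [← hw, ← hu]; simp
      rw [h1, h, map_add, map_mul, map_mul, map_pow, ← hu, add_mul]
      simp [mul_assoc]
  refine ⟨AddEquiv.ofBijective g.toAddMonoidHom hg, fun s v => ?_⟩
  show g (op s • v) = op (ψ s) • g v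
  rw [map_smulₛₗ]
  rfl

theorem split_theta (hS : IsSkewPolynomialRing α.toRingEquiv φ θ) (s : S) :
    ∃ r t, s = φ r + θ * t := by
  induction s using sk_ind hS with
  | h0 => exact ⟨0, 0, by simp⟩
  | hadd x y hx hy =>
    obtain ⟨r, t, rfl⟩ := hx
    obtain ⟨r', t', rfl⟩ := hy
    exact ⟨r + r', t + t', by rw [map_add, mul_add]; abel⟩
  | hm a n =>
    cases n with
    | zero => exact ⟨a, 0, by simp⟩
    | succ n =>
      refine ⟨0, φ (α.symm a) * θ ^ n, ?_⟩
      have := theta_pow hS 1 (α.symm a)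
      rw [pow_one, pow_one, AlgEquiv.apply_symm_apply] at this
      rw [← mul_assoc, this, pow_succ']
      simp [mul_assoc]

theorem faithful_of_surj (hX : IsLocalRing.maximalIdeal R = Ideal.span {X})
    (hord : ∀ n : ℕ, 0 < n → α ^ n ≠ 1)
    (hS : IsSkewPolynomialRing α.toRingEquiv φ θ)
    (V : Type u) [AddCommGroup V] [Module Sᵐᵒᵖ V] (hV : IsSimpleModule Sᵐᵒᵖ V)
    (hsurj : ∀ v : V, ∃ w : V, op (φ X) • w = v) : FaithfulSMul Sᵐᵒᵖ V := by
  have hnt : Nontrivial V := IsSimpleModule.nontrivial Sᵐᵒᵖ V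
  -- `θ^m` cannot kill `V`
  have hth : ∀ m : ℕ, ¬ ∀ v : V, op (θ ^ m) • v = 0 := by
    intro m hm
    have hK : ∃ w : V, w ≠ 0 ∧ op θ • w = 0 := by
      by_contra! hcon
      have : ∀ n : ℕ, ∀ v : V, v ≠ 0 → op (θ ^ n) • v ≠ 0 := by
        intro n
        induction n with
        | zero => intro v hv; simpa using hv
        | succ n ih =>
          intro v hv
          rw [pow_succ, op_mul, mul_smul]
          exact hcon _ (ih v hv)
      obtain ⟨v, hv⟩ := exists_ne (0 : V)
      exact this m v hv (hm v)
    obtain ⟨w, hw, hθ⟩ := hK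
    obtain ⟨w', hw'⟩ := hsurj w
    obtain ⟨s, hs⟩ := simple_gen hV hw w'
    obtain ⟨r, t, rfl⟩ := split_theta hS s
    rw [op_add, add_smul, op_mul, mul_smul, hθ, smul_zero, add_zero] at hs
    have h1 : op (φ (r * X)) • w = w := by rw [map_mul, op_mul, mul_smul, hs, hw']
    have h2 : op (φ (1 - r * X)) • w = 0 := by
      rw [map_sub, map_one, op_sub, sub_smul, h1, op_one, one_smul, sub_self]
    have h3 : IsUnit (1 - r * X) := by
      apply IsLocalRing.isUnit_one_sub_self_of_mem_nonunits
      rw [← IsLocalRing.mem_maximalIdeal, hX]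
      exact Ideal.mul_mem_left _ _ (Ideal.mem_span_singleton_self X)
    have h4 : IsUnit (op (φ (1 - r * X))) := (h3.map φ).op
    exact hw (h4.smul_eq_zero.mp h2)
  have hpinj : ∀ i j : ℕ, α ^ i = α ^ j → i = j := by
    have aux : ∀ i j : ℕ, i < j → α ^ i ≠ α ^ j := by
      intro i j hij h
      apply hord (j - i) (by omega)
      have : α ^ i * α ^ (j - i) = α ^ i * 1 := by
        rw [← pow_add, mul_one, h]; congr 1; omega
      exact mul_left_cancel this
    intro i j h
    rcases lt_trichotomy i j with h1 | h1 | h1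
    · exact absurd h (aux i j h1)
    · exact h1
    · exact absurd h.symm (aux j i h1)
  have key : ∀ n, ∀ s : S, (cf hS s).support.card ≤ n → (∀ v : V, op s • v = 0) → s = 0 := by
    intro n
    induction n with
    | zero =>
      intro s hs _
      have : cf hS s = 0 := by simpa using hs
      simpa using this
    | succ n ih =>
      intro s hs hann
      by_contra hs0
      have hne : cf hS s ≠ 0 := by simpa using hs0
      obtain ⟨m, hm⟩ := Finsupp.support_nonempty_iff.mpr hne
      have hr : ∀ r : R, φ ((α ^ m) r) * s - s * φ r = 0 := by
        intro r
        apply ih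
        · have hc : ∀ i, cf hS (φ ((α ^ m) r) * s - s * φ r) i =
              ((α ^ m) r - (α ^ i) r) * cf hS s i := by
            intro i
            rw [map_sub, Finsupp.sub_apply, cf_phi_mul, cf_mul_phi]; ring
          have hsub : (cf hS (φ ((α ^ m) r) * s - s * φ r)).support ⊆
              (cf hS s).support.erase m := by
            intro i hi
            rw [Finsupp.mem_support_iff, hc] at hi
            rw [Finset.mem_erase, Finsupp.mem_support_iff]
            constructor
            · rintro rfl; simp at hi
            · intro h; rw [h, mul_zero] at hi; exact hi rfl
          have := Finset.card_le_card hsub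
          rw [Finset.card_erase_of_mem hm] at this
          omega
        · intro v
          rw [op_sub, sub_smul, op_mul, op_mul, mul_smul, mul_smul, hann, hann, smul_zero, sub_zero]
      have hsupp : ∀ i, i ≠ m → cf hS s i = 0 := by
        intro i him
        by_contra hi
        apply him
        apply hpinj
        ext r
        have h1 := congrArg (fun x => cf hS x i) (hr r)
        simp only [map_sub, Finsupp.sub_apply, cf_phi_mul, cf_mul_phi, map_zero,
          Finsupp.zero_apply] at h1
        have h2 : ((α ^ m) r - (α ^ i) r) * cf hS s i = 0 := by rw [← h1]; ring
        exact (sub_eq_zero.mp ((mul_eq_zero.mp h2).resolve_right hi)).symm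
      have hseq : s = φ (cf hS s m) * θ ^ m := by
        apply (cf hS).injective
        rw [cf_mono]
        ext i
        rw [Finsupp.single_apply]
        split_ifs with h
        · rw [h]
        · exact hsupp i (fun h' => h h'.symm)
      have ha : cf hS s m ≠ 0 := Finsupp.mem_support_iff.mp hm
      obtain ⟨l, u, hu⟩ := IsDiscreteValuationRing.eq_unit_mul_pow_irreducible ha (X_irr hX)
      have hsl : ∀ (l : ℕ) (v : V), ∃ w : V, op (φ X ^ l) • w = v := by
        intro l
        induction l with
        | zero => intro v; exact ⟨v, by simp⟩
        | succ l ih =>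
          intro v
          obtain ⟨w, hw⟩ := hsurj v
          obtain ⟨w', hw'⟩ := ih w
          exact ⟨w', by rw [pow_succ, op_mul, mul_smul, hw', hw]⟩
      apply hth m
      intro v
      obtain ⟨w, hw⟩ := hsl l v
      have h1 := hann (op (φ ↑u⁻¹) • w)
      rw [hseq, hu, op_mul, mul_smul, ← mul_smul (op (φ _)), ← op_mul, ← map_mul,
        ← mul_assoc, Units.inv_mul, one_mul, map_pow, hw] at h1
      exact h1
  constructor
  intro m1 m2 h
  have := key _ (m1.unop - m2.unop) le_rfl (by
    intro v
    rw [op_sub, sub_smul, op_unop, op_unop, h, sub_self])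
  exact unop_injective (sub_eq_zero.mp this)

theorem faithful_surj_inj (hX : IsLocalRing.maximalIdeal R = Ideal.span {X})
    (hS : IsSkewPolynomialRing α.toRingEquiv φ θ)
    (hres : Function.Bijective ((IsLocalRing.residue R).comp (algebraMap k R)))
    (V : Type u) [AddCommGroup V] [Module Sᵐᵒᵖ V] (hV : IsSimpleModule Sᵐᵒᵖ V)
    (hf : FaithfulSMul Sᵐᵒᵖ V) :
    (∀ v : V, ∃ w : V, op (φ X) • w = v) ∧ (∀ v : V, op (φ X) • v = 0 → v = 0) := by
  have hne : ¬ ∀ v : V, op (φ X) • v = 0 := by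
    intro h
    apply phiX_ne hX hS
    apply op_injective
    apply hf.eq_of_smul_eq_smul (α := V)
    intro v
    rw [h]; simp
  constructor
  · intro v
    push Not at hne
    obtain ⟨w, hw⟩ := hne
    obtain ⟨s, hs⟩ := simple_gen hV hw v
    obtain ⟨t, ht⟩ := (X_normal hX hS hres 1 s).1
    rw [pow_one] at ht
    refine ⟨op t • w, ?_⟩
    rw [← hs, ← mul_smul, ← mul_smul, ← op_mul, ← op_mul, ht]
  · intro v hv
    by_contra hv0
    apply hne
    intro w
    obtain ⟨s, rfl⟩ := simple_gen hV hv0 w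
    obtain ⟨t, ht⟩ := (X_normal hX hS hres 1 s).2
    rw [pow_one] at ht
    rw [← mul_smul, ← op_mul, ht, op_mul, mul_smul, hv, smul_zero]

theorem surj_red (hX : IsLocalRing.maximalIdeal R = Ideal.span {X})
    (hS : IsSkewPolynomialRing α.toRingEquiv φ θ)
    (hres : Function.Bijective ((IsLocalRing.residue R).comp (algebraMap k R))) (z s : S)
    (h : ∃ c, 1 - s * φ X = z * c) : ∃ c, red hS hres (z * c) = 1 := by
  obtain ⟨c, hc⟩ := h
  exact ⟨c, by rw [← hc, map_sub, map_mul, red_X hX hS hres]; simp⟩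

theorem part1a (hX : IsLocalRing.maximalIdeal R = Ideal.span {X})
    (hS : IsSkewPolynomialRing α.toRingEquiv φ θ)
    (hres : Function.Bijective ((IsLocalRing.residue R).comp (algebraMap k R)))
    (hT : IsLocalizationAt (φ X) ψ)
    (V : Type u) [AddCommGroup V] [Module Sᵐᵒᵖ V] (hV : IsSimpleModule Sᵐᵒᵖ V)
    (hf : FaithfulSMul Sᵐᵒᵖ V) : ∃ z : S, Irreducible z ∧ Irreducible (ψ z) ∧
          Nonempty (V ≃ₗ[Sᵐᵒᵖ] rQuot S z) ∧ SModIsoOfT ψ V (rQuot T (ψ z)) := by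
  have hnt : Nontrivial V := IsSimpleModule.nontrivial Sᵐᵒᵖ V
  obtain ⟨hsurj, hinj⟩ := faithful_surj_inj hX hS hres V hV hf
  obtain ⟨v, hv⟩ := exists_ne (0 : V)
  let f : S →ₗ[Sᵐᵒᵖ] V :=
    { toFun := fun s => op s • v
      map_add' := fun a b => by rw [op_add, add_smul]
      map_smul' := fun m a => by
        show op (a * m.unop) • v = m • op a • v
        rw [op_mul, mul_smul, op_unop] }
  have hfs : Function.Surjective f := fun w => simple_gen hV hv w
  obtain ⟨w, hw⟩ := hsurj v
  obtain ⟨s, rfl⟩ := hfs w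
  have h1 : 1 - s * φ X ∈ LinearMap.ker f := by
    rw [LinearMap.mem_ker]
    show op (1 - s * φ X) • v = 0
    rw [op_sub, sub_smul, op_mul, mul_smul]
    have : op (φ X) • op s • v = v := hw
    rw [this]; simp
  have hI : LinearMap.ker f ≠ ⊥ := by
    intro h
    rw [h, Submodule.mem_bot] at h1
    have := congrArg (red hS hres) h1
    rw [map_sub, map_mul, red_X hX hS hres] at this
    simp at this
  obtain ⟨z, hz, hz0⟩ := principal hX hS hres _ hI (by
    intro a ha
    rw [LinearMap.mem_ker] at *
    have h2 : op (a * φ X) • v = 0 := ha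
    rw [op_mul, mul_smul] at h2
    exact hinj _ h2)
  rw [hz, mem_rSpan] at h1
  obtain ⟨c, hc⟩ := surj_red hX hS hres z s h1
  have e : V ≃ₗ[Sᵐᵒᵖ] rQuot S z :=
    ((Submodule.quotEquivOfEq _ _ hz.symm).trans (f.quotKerEquivOfSurjective hfs)).symm
  have hzne : z ≠ 0 := by rintro rfl; simp at hz0
  have hnd := sk_noZeroDiv hS
  have hndT := T_noZeroDiv (φ X) (fun n s => (X_normal hX hS hres n s).1) ψ hT
  obtain ⟨g, hg⟩ := iso_T hX hS hres hT z c hc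
  have hiso : SModIsoOfT ψ V (rQuot T (ψ z)) :=
    ⟨e.toAddEquiv.trans g, fun s v => by
      show g (e (op s • v)) = op (ψ s) • g (e v)
      rw [map_smul, hg]⟩
  refine ⟨z, irr_of_simple z hzne (IsSimpleModule.congr e.symm), ?_, ⟨e⟩, hiso⟩
  apply irr_of_simple
  · intro h
    exact hzne (hT.inj (by simpa using h))
  · obtain ⟨e', he'⟩ := hiso
    apply simple_of_gen e'.symm.toEquiv.nontrivial
    intro x hx y
    obtain ⟨s, hs⟩ := simple_gen hV (v := e'.symm x) (by simpa using hx) (e'.symm y)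
    refine ⟨ψ s, ?_⟩
    have := he' s (e'.symm x)
    rw [hs] at this
    simpa using this.symm

theorem part1b (hX : IsLocalRing.maximalIdeal R = Ideal.span {X})
    (hS : IsSkewPolynomialRing α.toRingEquiv φ θ)
    (hres : Function.Bijective ((IsLocalRing.residue R).comp (algebraMap k R)))
    (hT : IsLocalizationAt (φ X) ψ)
    (V : Type u) [AddCommGroup V] [Module Sᵐᵒᵖ V] (hV : IsSimpleModule Sᵐᵒᵖ V)
    (z : S) (e : V ≃ₗ[Sᵐᵒᵖ] rQuot S z) (hiso : SModIsoOfT ψ V (rQuot T (ψ z))) :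
    Irreducible z ∧ IsTypeB X φ z := by
  obtain ⟨g, hg⟩ := hiso
  have hsurj : ∀ v : V, ∃ w : V, op (φ X) • w = v := by
    intro v
    obtain ⟨u, hu⟩ := hT.unit
    refine ⟨g.symm (op (↑u⁻¹ : T) • g v), ?_⟩
    apply g.injective
    rw [hg, AddEquiv.apply_symm_apply, ← mul_smul, ← op_mul, ← hu]
    simp
  obtain ⟨w, hw⟩ := hsurj (e.symm (Submodule.Quotient.mk 1))
  obtain ⟨s, hs⟩ := Submodule.mkQ_surjective _ (e w)
  have h1 : (Submodule.Quotient.mk (s * φ X) : rQuot S z) = Submodule.Quotient.mk 1 := by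
    have := congrArg e hw
    rw [map_smul, ← hs, LinearEquiv.apply_symm_apply] at this
    exact this
  obtain ⟨c, hc⟩ := surj_red hX hS hres z s
    ((mem_rSpan _ _).mp ((Submodule.Quotient.eq _).mp h1.symm))
  have hsim : IsSimpleModule Sᵐᵒᵖ (rQuot S z) := IsSimpleModule.congr e.symm
  have hnd := sk_noZeroDiv hS
  have hirr : Irreducible z := by
    apply irr_of_simple z _ hsim
    rintro rfl
    simp at hc
  refine ⟨hirr, ?_⟩
  rw [map_mul] at hc
  have hu : IsUnit (red hS hres z) := IsUnit.of_mul_eq_one _ hc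
  obtain ⟨a, ha, haz⟩ := Polynomial.isUnit_iff.mp hu
  obtain ⟨r, rfl⟩ := IsLocalRing.residue_surjective a
  have hr : IsUnit r := by
    by_contra hn
    have := (IsLocalRing.residue_eq_zero_iff r).mpr ((IsLocalRing.mem_maximalIdeal r).mpr hn)
    exact ha.ne_zero this
  obtain ⟨u, rfl⟩ := hr
  have hk : red hS hres (φ ↑u⁻¹ * z - 1) = 0 := by
    rw [map_sub, map_mul, ← haz, red_phi, ← Polynomial.C_mul, ← map_mul]
    simp
  obtain ⟨t, ht⟩ := (red_ker hX hS hres _ hk).1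
  have hz1 : φ ↑u⁻¹ * z = 1 + φ X * t := by rw [← ht]; abel
  refine ⟨Units.map φ.toMonoidHom u⁻¹, t, ?_, hz1⟩
  rintro ⟨b, rfl⟩
  apply hirr.not_isUnit
  have h3 : IsUnit (1 - (-b) * X) := by
    apply IsLocalRing.isUnit_one_sub_self_of_mem_nonunits
    rw [← IsLocalRing.mem_maximalIdeal, hX]
    exact Ideal.mul_mem_left _ _ (Ideal.mem_span_singleton_self X)
  have h4 : φ (1 - (-b) * X) = φ ↑u⁻¹ * z := by
    rw [hz1, ← map_mul, ← map_one φ, ← map_add]; congr 1; ring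
  have h5 := h3.map φ
  rw [h4] at h5
  have h6 : IsUnit (φ (u : R)) := u.isUnit.map φ
  have h7 := h6.mul h5
  rwa [← mul_assoc, ← map_mul, Units.mul_inv, map_one, one_mul] at h7

theorem part2_simple (hX : IsLocalRing.maximalIdeal R = Ideal.span {X})
    (hS : IsSkewPolynomialRing α.toRingEquiv φ θ)
    (hres : Function.Bijective ((IsLocalRing.residue R).comp (algebraMap k R)))
    (z c : S) (hirr : Irreducible z) (hc : red hS hres (z * c) = 1) :
    IsSimpleModule Sᵐᵒᵖ (rQuot S z) := by
  have hnd := sk_noZeroDiv hS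
  have hntS : Nontrivial S := ⟨φ X, 0, phiX_ne hX hS⟩
  have hdom : IsDomain S := NoZeroDivisors.to_isDomain S
  have hnt : Nontrivial (rQuot S z) := by
    refine ⟨Submodule.Quotient.mk 1, 0, ?_⟩
    rw [Ne, Submodule.Quotient.mk_eq_zero, mem_rSpan]
    rintro ⟨b, hb⟩
    apply hirr.not_isUnit
    have hb0 : b ≠ 0 := by rintro rfl; simp at hb
    have : b * z = 1 := by
      apply mul_right_cancel₀ hb0
      rw [mul_assoc, ← hb, one_mul, mul_one]
    exact ⟨⟨z, b, hb.symm, this⟩, rfl⟩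
  apply simple_of_gen hnt
  intro x hx y
  obtain ⟨a, rfl⟩ := Submodule.mkQ_surjective _ x
  obtain ⟨b, rfl⟩ := Submodule.mkQ_surjective _ y
  let I : Submodule Sᵐᵒᵖ S :=
    { carrier := {s | ∃ (n : ℕ) (x y : S), s * φ X ^ n = a * x + z * y}
      zero_mem' := ⟨0, 0, 0, by simp⟩
      add_mem' := by
        rintro s t ⟨n, x, y, h⟩ ⟨m, x', y', h'⟩
        refine ⟨n + m, x * φ X ^ m + x' * φ X ^ n, y * φ X ^ m + y' * φ X ^ n, ?_⟩
        have e1 : s * φ X ^ (n + m) = (a * x + z * y) * φ X ^ m := by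
          rw [pow_add, ← mul_assoc, h]
        have e2 : t * φ X ^ (n + m) = (a * x' + z * y') * φ X ^ n := by
          rw [add_comm, pow_add, ← mul_assoc, h']
        rw [add_mul, e1, e2]
        simp only [add_mul, mul_add, mul_assoc]
        abel
      smul_mem' := by
        rintro t s ⟨n, x, y, h⟩
        obtain ⟨t', ht'⟩ := (X_normal hX hS hres n t.unop).2
        refine ⟨n, x * t', y * t', ?_⟩
        show s * t.unop * φ X ^ n = _
        rw [mul_assoc, ht', ← mul_assoc, h, add_mul, mul_assoc, mul_assoc] }
  have haI : a ∈ I := ⟨0, 1, 0, by simp⟩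
  have hzI : z ∈ I := ⟨0, 0, 1, by simp⟩
  have hz0 : z ≠ 0 := hirr.ne_zero
  obtain ⟨d, hd, -⟩ := principal hX hS hres I
    (fun h => hz0 (by rw [h] at hzI; simpa using hzI)) (by
      rintro s ⟨n, x, y, h⟩
      exact ⟨n + 1, x, y, by rw [pow_succ', ← mul_assoc, h]⟩)
  rw [hd, mem_rSpan] at hzI haI
  obtain ⟨f, hf⟩ := hzI
  obtain ⟨a', ha'⟩ := haI
  have h1I : (1 : S) ∈ I := by
    rcases hirr.isUnit_or_isUnit hf with h | h
    · obtain ⟨u, rfl⟩ := h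
      rw [hd, mem_rSpan]
      exact ⟨↑u⁻¹, by simp⟩
    · exfalso
      obtain ⟨u, rfl⟩ := h
      apply hx
      rw [Submodule.mkQ_apply, Submodule.Quotient.mk_eq_zero, mem_rSpan]
      refine ⟨↑u⁻¹ * a', ?_⟩
      rw [hf, ha']
      simp [mul_assoc]
  obtain ⟨n, p, q, hpq⟩ := h1I
  rw [one_mul] at hpq
  obtain ⟨b', f', hb'⟩ := X_div hX hS hres z c hc n b
  obtain ⟨b'', hb''⟩ := (X_normal hX hS hres n b').2
  refine ⟨p * b'', ?_⟩
  show (Submodule.Quotient.mk (a * (p * b'')) : rQuot S z) = Submodule.Quotient.mk b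
  rw [Submodule.Quotient.eq, mem_rSpan]
  refine ⟨-(q * b'' + f'), ?_⟩
  rw [hb', hb'', hpq]
  noncomm_ring

end Main

/-- (1) Every faithful simple right `S`-module `V` is of the form
`V ≅ S/zS ≅ T/zT` for some `z ∈ S` irreducible in both `S` and `T`; moreover any
`z ∈ S` with `V ≅ S/zS ≅ T/zT` is a type (B) irreducible.  (2) Conversely, if `z ∈ S`
is irreducible in both `S` and `T` and has type (B), then `S/zS ≅ T/zT` is a faithful
simple right `S`-module. -/
theorem faithful_simple_modules_classification
    {k : Type u} [Field k]
    {R : Type u} [CommRing R] [IsDomain R] [IsDiscreteValuationRing R] [Algebra k R]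
    (X : R) (hX : IsLocalRing.maximalIdeal R = Ideal.span {X})
    (hres : Function.Bijective ((IsLocalRing.residue R).comp (algebraMap k R)))
    (α : R ≃ₐ[k] R) (hord : ∀ n : ℕ, 0 < n → α ^ n ≠ 1)
    {S : Type u} [Ring S] (φ : R →+* S) (θ : S)
    (hS : IsSkewPolynomialRing α.toRingEquiv φ θ)
    {T : Type u} [Ring T] (ψ : S →+* T) (hT : IsLocalizationAt (φ X) ψ) :
    (∀ (V : Type u) [AddCommGroup V] [Module Sᵐᵒᵖ V],
      IsSimpleModule Sᵐᵒᵖ V → FaithfulSMul Sᵐᵒᵖ V →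
      (∃ z : S, Irreducible z ∧ Irreducible (ψ z) ∧
          Nonempty (V ≃ₗ[Sᵐᵒᵖ] rQuot S z) ∧ SModIsoOfT ψ V (rQuot T (ψ z))) ∧
      (∀ z : S, Nonempty (V ≃ₗ[Sᵐᵒᵖ] rQuot S z) → SModIsoOfT ψ V (rQuot T (ψ z)) →
          Irreducible z ∧ IsTypeB X φ z)) ∧
    (∀ z : S, Irreducible z → Irreducible (ψ z) → IsTypeB X φ z →
      IsSimpleModule Sᵐᵒᵖ (rQuot S z) ∧ FaithfulSMul Sᵐᵒᵖ (rQuot S z) ∧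
        SModIsoOfT ψ (rQuot S z) (rQuot T (ψ z))) := by
  refine ⟨fun V _ _ hV hf => ⟨part1a hX hS hres hT V hV hf, fun z ⟨e⟩ hiso =>
    part1b hX hS hres hT V hV z e hiso⟩, ?_⟩
  rintro z hirr - ⟨u, s, -, hus⟩
  have hc : red hS hres (z * u) = 1 := by
    rw [map_mul, mul_comm, ← map_mul, hus, map_add, map_mul, red_X hX hS hres]
    simp
  have hsim := part2_simple hX hS hres z u hirr hc
  refine ⟨hsim, ?_, iso_T hX hS hres hT z u hc⟩
  apply faithful_of_surj hX hord hS _ hsim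
  intro v
  obtain ⟨a, rfl⟩ := Submodule.mkQ_surjective _ v
  obtain ⟨b, d, h⟩ := X_div hX hS hres z u hc 1 a
  refine ⟨Submodule.Quotient.mk b, ?_⟩
  show (Submodule.Quotient.mk (b * φ X) : rQuot S z) = Submodule.Quotient.mk a
  rw [Submodule.Quotient.eq, mem_rSpan]
  refine ⟨-d, ?_⟩
  rw [h, pow_one]
  noncomm_ring
end

section
/- Let z ∈ S be a type (B) element irreducible in both S and T, and let y ∈ S∖XS. Then the following are equivalent: (a) S/zS ≅ S/yS as S-modules; (b) T/zT ≅ T/yT as T-modules; (c) z and y are similar in T. Moreover, when these equivalent conditions hold, y is a type (B) irreducible element of S. -/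
open MulOpposite

universe u

theorem mem_rSpan_iff {S : Type u} [Ring S] (z w : S) : w ∈ rSpan S z ↔ z ∣ w := by
  rw [Submodule.mem_span_singleton]
  constructor
  · rintro ⟨a, rfl⟩
    exact ⟨a.unop, rfl⟩
  · rintro ⟨c, rfl⟩
    exact ⟨op c, rfl⟩

/-- Left multiplication as a map of right modules. -/
def lmulRight {S : Type u} [Ring S] (a : S) : S →ₗ[Sᵐᵒᵖ] S where
  toFun s := a * s
  map_add' := mul_add a
  map_smul' c s := by
    show a * (s * c.unop) = a * s * c.unop
    rw [mul_assoc]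

theorem rQuot_iso_iff {S : Type u} [Ring S] (z y : S) :
    Nonempty (rQuot S z ≃ₗ[Sᵐᵒᵖ] rQuot S y) ↔
      ∃ a : S, (∀ s, y ∣ a * s ↔ z ∣ s) ∧ ∃ s t, a * s + y * t = 1 := by
  constructor
  · rintro ⟨f⟩
    obtain ⟨a, ha⟩ := Submodule.mkQ_surjective (rSpan S y) (f ((rSpan S z).mkQ 1))
    have key : ∀ s, f ((rSpan S z).mkQ s) = (rSpan S y).mkQ (a * s) := by
      intro s
      have h1 : (rSpan S z).mkQ s = op s • (rSpan S z).mkQ 1 := by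
        rw [← map_smul]; simp
      rw [h1, map_smul, ← ha, ← map_smul]; simp
    refine ⟨a, fun s => ?_, ?_⟩
    · rw [← mem_rSpan_iff, ← mem_rSpan_iff, ← Submodule.Quotient.mk_eq_zero,
        ← Submodule.Quotient.mk_eq_zero, ← Submodule.mkQ_apply, ← Submodule.mkQ_apply, ← key]
      simp only [map_eq_zero_iff f f.injective]
    · obtain ⟨s, hs⟩ := Submodule.mkQ_surjective (rSpan S z) (f.symm ((rSpan S y).mkQ 1))
      have h := key s
      rw [hs, LinearEquiv.apply_symm_apply] at h
      have h2 : (1 : S) - a * s ∈ rSpan S y := (Submodule.Quotient.eq _).1 h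
      rw [mem_rSpan_iff] at h2
      obtain ⟨t, ht⟩ := h2
      exact ⟨s, t, by rw [← ht]; abel⟩
  · rintro ⟨a, ha, s, t, hst⟩
    let g : S →ₗ[Sᵐᵒᵖ] rQuot S y := (rSpan S y).mkQ.comp (lmulRight a)
    have hk : LinearMap.ker g = rSpan S z := by
      ext w
      rw [mem_rSpan_iff, ← ha, ← mem_rSpan_iff, LinearMap.mem_ker]
      exact Submodule.Quotient.mk_eq_zero _
    have hsurj : Function.Surjective g := by
      intro q
      obtain ⟨w, rfl⟩ := Submodule.mkQ_surjective (rSpan S y) q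
      refine ⟨s * w, ?_⟩
      show Submodule.Quotient.mk (a * (s * w)) = Submodule.Quotient.mk w
      rw [Submodule.Quotient.eq, mem_rSpan_iff]
      refine ⟨-(t * w), ?_⟩
      have : a * (s * w) - w = a * s * w - (a * s + y * t) * w := by
        rw [hst, one_mul, mul_assoc]
      rw [this]; noncomm_ring
    exact ⟨(Submodule.quotEquivOfEq _ _ hk.symm).trans (g.quotKerEquivOfSurjective hsurj)⟩

section core
variable {S T P : Type u} [Ring S] [Ring T] [Ring P] [IsDomain P] {x : S} {ψ : S →+* T}
  (hT : IsLocalizationAt x ψ) (π : S →+* P) (hπ : ∀ s, π s = 0 ↔ x ∣ s)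
  (hx : ∀ s, ∃ s', x * s = s' * x)

include hT in
theorem core_xl (n : ℕ) {a b : S} (h : x ^ n * a = x ^ n * b) : a = b := by
  apply hT.inj
  have := congrArg ψ h
  rw [map_mul, map_mul, map_pow] at this
  exact (hT.unit.pow n).mul_left_cancel this

include hT in
theorem core_xr (n : ℕ) {a b : S} (h : a * x ^ n = b * x ^ n) : a = b := by
  apply hT.inj
  have := congrArg ψ h
  rw [map_mul, map_mul, map_pow] at this
  exact (hT.unit.pow n).mul_right_cancel this

include hx in
theorem core_swap (n : ℕ) (s : S) : ∃ s', x ^ n * s = s' * x ^ n := by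
  induction n generalizing s with
  | zero => exact ⟨s, by simp⟩
  | succ n ih =>
    obtain ⟨s1, h1⟩ := hx s
    obtain ⟨s2, h2⟩ := ih s1
    exact ⟨s2, by rw [pow_succ, mul_assoc, h1, ← mul_assoc, h2, mul_assoc]⟩

include hπ in
theorem core_swap' (n : ℕ) (s : S) : ∃ s', s * x ^ n = x ^ n * s' := by
  induction n generalizing s with
  | zero => exact ⟨s, by simp⟩
  | succ n ih =>
    obtain ⟨s1, h1⟩ := ih s
    have : x ∣ s1 * x := by
      rw [← hπ, map_mul, (hπ x).2 dvd_rfl, mul_zero]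
    obtain ⟨s2, h2⟩ := this
    exact ⟨s2, by rw [pow_succ, ← mul_assoc, h1, mul_assoc, h2, mul_assoc]⟩

include hT hπ hx in
/-- `yT ∩ S = yS` for `y ∉ XS`. -/
theorem core_contract {y : S} (hy : ¬ x ∣ y) (s : S) : ψ y ∣ ψ s ↔ y ∣ s := by
  constructor
  · rintro ⟨t, ht⟩
    obtain ⟨t', n, h⟩ := hT.surj t
    have h1 : s * x ^ n = y * t' := by
      apply hT.inj
      rw [map_mul, map_mul, map_pow, ht, mul_assoc, h]
    clear h ht
    induction n generalizing t' with
    | zero => exact ⟨t', by simpa using h1⟩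
    | succ n ih =>
      have h2 : π (y * t') = 0 := by
        rw [← h1, pow_succ, map_mul, map_mul, (hπ x).2 dvd_rfl, mul_zero, mul_zero]
      rw [map_mul] at h2
      rcases mul_eq_zero.1 h2 with h3 | h3
      · exact absurd ((hπ y).1 h3) hy
      · obtain ⟨w, rfl⟩ := (hπ t').1 h3
        obtain ⟨w', hw⟩ := hx w
        refine ih w' ?_
        apply core_xr hT 1
        rw [pow_one, mul_assoc, ← pow_succ, h1, hw, mul_assoc]
  · exact map_dvd ψ

include hπ hx in
theorem core_comax {z c d : S} (h : z * c + x * d = 1) (n : ℕ) :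
    ∃ c d, z * c + d * x ^ n = 1 := by
  induction n with
  | zero => exact ⟨0, 1, by simp⟩
  | succ n ih =>
    obtain ⟨c', d', h'⟩ := ih
    obtain ⟨e, he⟩ := core_swap' π hπ n d'
    obtain ⟨e, he⟩ := hx (d * d' * x ^ n)
    obtain ⟨g, hg⟩ := hx (d * d')
    refine ⟨c' + c * d' * x ^ n, g, ?_⟩
    calc z * (c' + c * d' * x ^ n) + g * x ^ (n + 1)
        = z * c' + z * c * d' * x ^ n + g * x * x ^ n := by
          rw [pow_succ']; noncomm_ring
      _ = z * c' + (z * c + x * d) * d' * x ^ n := by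
          rw [← hg]; noncomm_ring
      _ = 1 := by rw [h, one_mul, h']

include hT hπ hx in
/-- `S → T/zT` is surjective. -/
theorem core_surj {z c d : S} (h : z * c + x * d = 1) (t : T) :
    ∃ (s : S) (w : T), t = ψ s + ψ z * w := by
  obtain ⟨s, n, hs⟩ := hT.surj t
  obtain ⟨c', d', h'⟩ := core_comax π hπ hx h n
  obtain ⟨s', hs'⟩ := core_swap hx n s
  obtain ⟨v, hv⟩ := hT.unit.pow n
  refine ⟨d' * s', ψ (c' * s) * (↑v⁻¹ : T), ?_⟩
  rw [← hv] at hs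
  have h2 : t = ψ s * (↑v⁻¹ : T) := by rw [← hs, mul_assoc, Units.mul_inv, mul_one]
  have h3 : ψ s = ψ z * ψ (c' * s) + ψ (d' * s') * v := by
    rw [hv, ← map_pow, ← map_mul, ← map_mul, ← map_add, mul_assoc, ← hs', ← mul_assoc,
      ← mul_assoc, ← add_mul, h', one_mul]
  rw [h2, h3, add_mul, mul_assoc (ψ (d' * s')), Units.mul_inv, mul_one, mul_assoc, add_comm]

include hT hπ hx in
/-- If `zT` is a maximal right ideal then `zS` is a maximal right ideal. -/
theorem core_max {z c d : S} (h : z * c + x * d = 1) (hzx : ¬ x ∣ z)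
    (hmax : ∀ b : S, ¬ ψ z ∣ ψ b → ∃ t t', ψ b * t + ψ z * t' = 1) (b : S) (hb : ¬ z ∣ b) :
    ∃ e w, b * e + z * w = 1 := by
  obtain ⟨t, t', htt⟩ := hmax b (by rwa [core_contract hT π hπ hx hzx])
  obtain ⟨s, n, hs⟩ := hT.surj t
  have h1 : ψ z ∣ ψ (x ^ n - b * s) := by
    refine ⟨t' * ψ x ^ n, ?_⟩
    rw [map_sub, map_mul, ← hs, map_pow, ← mul_assoc, ← mul_assoc, ← one_mul (ψ x ^ n),
      ← mul_assoc, ← mul_assoc, mul_one, mul_one, ← sub_mul, ← htt]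
    congr 1; abel
  rw [core_contract hT π hπ hx hzx] at h1
  obtain ⟨w, hw⟩ := h1
  obtain ⟨c', d', h'⟩ := core_comax π hπ hx h n
  obtain ⟨e, he⟩ := core_swap' π hπ n d'
  refine ⟨s * e, c' + w * e, ?_⟩
  rw [he] at h'
  have hw' : x ^ n = b * s + z * w := by rw [← hw]; abel
  rw [← h', hw']; noncomm_ring

include hT hπ hx in
theorem core_iso {z y c d : S} (h : z * c + x * d = 1) (hzx : ¬ x ∣ z) (hyx : ¬ x ∣ y)
    (hmax : ∀ b : S, ¬ ψ z ∣ ψ b → ∃ t t', ψ b * t + ψ z * t' = 1)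
    (hzu : ¬ ψ z ∣ 1) :
    (∃ a : S, (∀ s, y ∣ a * s ↔ z ∣ s) ∧ ∃ s t, a * s + y * t = 1) ↔
    (∃ a : T, (∀ s, ψ y ∣ a * s ↔ ψ z ∣ s) ∧ ∃ s t, a * s + ψ y * t = 1) := by
  have unitdvd : ∀ (v : Tˣ) (p q : T), p ∣ q * v ↔ p ∣ q := by
    intro v p q
    constructor
    · rintro ⟨r, hr⟩
      exact ⟨r * (↑v⁻¹ : T), by rw [← mul_assoc, ← hr, mul_assoc, Units.mul_inv, mul_one]⟩
    · intro h; exact Dvd.dvd.mul_right h _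
  constructor
  · rintro ⟨a, ha, s, t, hst⟩
    refine ⟨ψ a, fun w => ?_, ψ s, ψ t, by rw [← map_mul, ← map_mul, ← map_add, hst, map_one]⟩
    obtain ⟨w', n, hw⟩ := hT.surj w
    obtain ⟨v, hv⟩ := hT.unit.pow n
    rw [← hv] at hw
    rw [← unitdvd v, mul_assoc, hw, ← map_mul, core_contract hT π hπ hx hyx, ha,
      ← core_contract hT π hπ hx hzx, ← hw, unitdvd]
  · rintro ⟨a, ha, b, t, hbt⟩
    obtain ⟨b', w, rfl⟩ := core_surj hT π hπ hx h b
    obtain ⟨w1, hw1⟩ := (ha (ψ z)).2 dvd_rfl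
    have hab : a * ψ b' + ψ y * (w1 * w + t) = 1 := by
      rw [← hbt, mul_add, mul_add, ← mul_assoc, ← hw1]; noncomm_ring
    have hyu : ¬ ψ y ∣ 1 := by
      intro hy1
      exact hzu ((ha 1).1 (hy1.trans (one_dvd _)))
    have hb' : ¬ z ∣ b' := by
      intro hz
      have h1 : ψ y ∣ a * ψ b' := (ha _).2 (map_dvd ψ hz)
      apply hyu
      rw [← hab]
      exact dvd_add h1 (dvd_mul_right _ _)
    obtain ⟨e, w2, hew⟩ := core_max hT π hπ hx h hzx hmax b' hb'
    have hae : ∃ g, a = ψ e + ψ y * g := by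
      refine ⟨w1 * ψ w2 - (w1 * w + t) * ψ e, ?_⟩
      have h3 : a * ψ b' = 1 - ψ y * (w1 * w + t) := by rw [← hab]; abel
      calc a = a * ψ (b' * e + z * w2) := by rw [hew, map_one, mul_one]
        _ = (a * ψ b') * ψ e + (a * ψ z) * ψ w2 := by
            rw [map_add, map_mul, map_mul]; noncomm_ring
        _ = _ := by rw [h3, hw1]; noncomm_ring
    obtain ⟨g, hg⟩ := hae
    refine ⟨e, fun s => ?_, b', ?_⟩
    · rw [← core_contract hT π hπ hx hyx, ← core_contract hT π hπ hx hzx, ← ha, hg, map_mul, add_mul,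
        mul_assoc (ψ y)]
      exact (dvd_add_left (dvd_mul_right _ _)).symm
    · have h6 : ψ y ∣ ψ (1 - e * b') := by
        refine ⟨g * ψ b' + (w1 * w + t), ?_⟩
        rw [map_sub, map_one, map_mul, ← hab, hg]; noncomm_ring
      rw [core_contract hT π hπ hx hyx] at h6
      obtain ⟨t', ht'⟩ := h6
      exact ⟨t', by rw [← ht']; abel⟩

include hπ in
theorem core_type {z y c d : S} (h : z * c + x * d = 1)
    (hmax : ∀ b : S, ¬ z ∣ b → ∃ e w, b * e + z * w = 1)
    (hiso : ∃ a : S, (∀ s, y ∣ a * s ↔ z ∣ s) ∧ ∃ s t, a * s + y * t = 1) :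
    (∃ c d, y * c + x * d = 1) ∧ ∀ b : S, ¬ y ∣ b → ∃ e w, b * e + y * w = 1 := by
  obtain ⟨a, ha, s, t, hst⟩ := hiso
  obtain ⟨w1, hw1⟩ := (ha z).2 dvd_rfl
  constructor
  · obtain ⟨a', ha'⟩ := core_swap' π hπ 1 a
    rw [pow_one] at ha'
    refine ⟨w1 * c * s + t, a' * d * s, ?_⟩
    calc y * (w1 * c * s + t) + x * (a' * d * s)
        = (y * w1) * c * s + y * t + (x * a') * d * s := by noncomm_ring
      _ = a * (z * c + x * d) * s + y * t := by rw [← hw1, ← ha']; noncomm_ring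
      _ = 1 := by rw [h, mul_one, hst]
  · intro b hb
    have hb1 : b = a * (s * b) + y * (t * b) := by
      calc b = (a * s + y * t) * b := by rw [hst, one_mul]
        _ = _ := by noncomm_ring
    have hsb : ¬ z ∣ s * b := by
      intro hz
      apply hb
      rw [hb1]
      exact dvd_add ((ha _).2 hz) (dvd_mul_right _ _)
    obtain ⟨e, w, hew⟩ := hmax _ hsb
    refine ⟨e * s, t + w1 * w * s - t * b * e * s, ?_⟩
    have h5 : s * b * e = 1 - z * w := by rw [← hew]; abel
    calc b * (e * s) + y * (t + w1 * w * s - t * b * e * s)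
        = (a * (s * b) + y * (t * b)) * (e * s) + y * (t + w1 * w * s - t * b * e * s) := by
          rw [← hb1]
      _ = a * (s * b * e) * s + y * t + (y * w1) * w * s := by noncomm_ring
      _ = a * s + y * t := by rw [h5, ← hw1]; noncomm_ring
      _ = 1 := hst

end core

section skew
variable {R S : Type u} [CommRing R] [IsDomain R] [IsDiscreteValuationRing R] [Ring S]
  {X : R} (hX : IsLocalRing.maximalIdeal R = Ideal.span {X})
  {α : R ≃+* R} {φ : R →+* S} {θ : S} (hS : IsSkewPolynomialRing α φ θ)

include hX in
theorem skew_X_dvd_iff (r : R) : X ∣ r ↔ IsLocalRing.residue R r = 0 := by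
  rw [IsLocalRing.residue_eq_zero_iff, hX, Ideal.mem_span_singleton]

include hX in
theorem skew_dvd_aut (β : R ≃+* R) : X ∣ β X := by
  rw [skew_X_dvd_iff hX, IsLocalRing.residue_eq_zero_iff, IsLocalRing.mem_maximalIdeal,
    mem_nonunits_iff, MulEquiv.isUnit_map, ← mem_nonunits_iff, ← IsLocalRing.mem_maximalIdeal, hX]
  exact Ideal.mem_span_singleton_self X

include hS in
theorem skew_comm (n : ℕ) (r : R) : θ ^ n * φ r = φ ((α ^ n) r) * θ ^ n := by
  induction n generalizing r with
  | zero => simp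
  | succ n ih =>
    rw [pow_succ, mul_assoc, hS.commutes, ← mul_assoc, ih, mul_assoc, pow_succ α]
    rfl

/-- The additive isomorphism between finitely supported functions and `S`. -/
noncomputable def skewEquiv : (ℕ →₀ R) ≃+ S :=
  AddEquiv.ofBijective
    (Finsupp.liftAddHom fun n => (AddMonoidHom.mulRight (θ ^ n)).comp φ.toAddMonoidHom) hS.bijective

theorem skewEquiv_single (n : ℕ) (r : R) : skewEquiv hS (Finsupp.single n r) = φ r * θ ^ n := by
  simp [skewEquiv]

include hS in
theorem skew_induction {p : S → Prop} (h0 : p 0) (hadd : ∀ a b, p a → p b → p (a + b))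
    (hm : ∀ n r, p (φ r * θ ^ n)) (s : S) : p s := by
  obtain ⟨f, rfl⟩ := (skewEquiv hS).surjective s
  induction f using Finsupp.induction_linear with
  | zero => simpa using h0
  | add f g hf hg => rw [map_add]; exact hadd _ _ hf hg
  | single n r => rw [skewEquiv_single]; exact hm n r

/-- The reduction map modulo `X`, as an additive map. -/
noncomputable def skewRedAdd : S →+ Polynomial (IsLocalRing.ResidueField R) :=
  (Finsupp.liftAddHom fun n => (Polynomial.monomial n).toAddMonoidHom.comp
    (IsLocalRing.residue R).toAddMonoidHom).comp (skewEquiv hS).symm.toAddMonoidHom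

theorem skewRedAdd_mon (n : ℕ) (r : R) :
    skewRedAdd hS (φ r * θ ^ n) = Polynomial.monomial n (IsLocalRing.residue R r) := by
  rw [← skewEquiv_single hS]
  simp [skewRedAdd]

theorem skewRedAdd_coeff (f : ℕ →₀ R) (n : ℕ) :
    (skewRedAdd hS (skewEquiv hS f)).coeff n = IsLocalRing.residue R (f n) := by
  induction f using Finsupp.induction_linear with
  | zero => simp
  | add f g hf hg => rw [map_add, map_add, Polynomial.coeff_add, hf, hg]; simp
  | single m r =>
    rw [skewEquiv_single, skewRedAdd_mon, Polynomial.coeff_monomial, Finsupp.single_apply]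
    split_ifs <;> simp

variable (hα : ∀ r, IsLocalRing.residue R (α r) = IsLocalRing.residue R r)

include hα in
theorem skew_res_pow (n : ℕ) (r : R) :
    IsLocalRing.residue R ((α ^ n) r) = IsLocalRing.residue R r := by
  induction n with
  | zero => simp
  | succ n ih => rw [pow_succ']; exact (hα _).trans ih

/-- The reduction map modulo `X`. -/
noncomputable def skewRed : S →+* Polynomial (IsLocalRing.ResidueField R) :=
  { skewRedAdd hS with
    map_one' := by
      have := skewRedAdd_mon hS 0 1
      simpa using this
    map_mul' := by
      show ∀ a b, skewRedAdd hS (a * b) = skewRedAdd hS a * skewRedAdd hS b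
      intro a b
      induction a using skew_induction hS with
      | h0 => simp
      | hadd a a' h h' => rw [add_mul, map_add, h, h', map_add, add_mul]
      | hm n r =>
        induction b using skew_induction hS with
        | h0 => simp
        | hadd a a' h h' => rw [mul_add, map_add, h, h', map_add, mul_add]
        | hm m r' =>
          have h1 : φ r * θ ^ n * (φ r' * θ ^ m) = φ (r * (α ^ n) r') * θ ^ (n + m) := by
            rw [mul_assoc, ← mul_assoc (θ ^ n), skew_comm hS, map_mul, pow_add]
            simp only [mul_assoc]
          rw [h1, skewRedAdd_mon, skewRedAdd_mon, skewRedAdd_mon, Polynomial.monomial_mul_monomial,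
            map_mul, skew_res_pow hα] }

theorem skewRed_coeff (f : ℕ →₀ R) (n : ℕ) :
    (skewRed hS hα (skewEquiv hS f)).coeff n = IsLocalRing.residue R (f n) :=
  skewRedAdd_coeff hS f n

theorem skewRed_mon (n : ℕ) (r : R) :
    skewRed hS hα (φ r * θ ^ n) = Polynomial.monomial n (IsLocalRing.residue R r) :=
  skewRedAdd_mon hS n r

theorem skewRed_C (r : R) :
    skewRed hS hα (φ r) = Polynomial.C (IsLocalRing.residue R r) := by
  simpa using skewRed_mon hS hα 0 r

include hS in
theorem skewEquiv_mul_left (r : R) (f : ℕ →₀ R) :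
    φ r * skewEquiv hS f = skewEquiv hS (r • f) := by
  induction f using Finsupp.induction_linear with
  | zero => simp
  | add f g hf hg => rw [map_add, mul_add, hf, hg, smul_add, map_add]
  | single n s =>
    rw [Finsupp.smul_single, skewEquiv_single, skewEquiv_single, smul_eq_mul, map_mul, mul_assoc]

include hX in
theorem skewRed_ker (s : S) : skewRed hS hα s = 0 ↔ φ X ∣ s := by
  constructor
  · obtain ⟨f, rfl⟩ := (skewEquiv hS).surjective s
    intro h
    have h1 : ∀ n, X ∣ f n := fun n => by
      rw [skew_X_dvd_iff hX, ← skewRed_coeff hS hα, h, Polynomial.coeff_zero]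
    choose g hg using h1
    have : ∀ n ∈ f.support, φ X ∣ φ (f n) * θ ^ n := fun n _ =>
      ⟨φ (g n) * θ ^ n, by rw [← mul_assoc, ← map_mul, ← hg]⟩
    have h2 : skewEquiv hS f = f.sum fun n r => φ r * θ ^ n := rfl
    rw [h2]
    exact Finset.dvd_sum this
  · rintro ⟨w, rfl⟩
    have : IsLocalRing.residue R X = 0 := (skew_X_dvd_iff hX X).1 dvd_rfl
    rw [map_mul, skewRed_C, this, map_zero, zero_mul]

include hX hS in
theorem skew_normal (s : S) : ∃ s', φ X * s = s' * φ X := by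
  induction s using skew_induction hS with
  | h0 => exact ⟨0, by simp⟩
  | hadd a b ha hb =>
    obtain ⟨a', ha⟩ := ha
    obtain ⟨b', hb⟩ := hb
    exact ⟨a' + b', by rw [mul_add, ha, hb, add_mul]⟩
  | hm n r =>
    obtain ⟨c, hc⟩ := skew_dvd_aut hX (α ^ n).symm
    have h1 : X = (α ^ n) X * (α ^ n) c := by
      rw [← map_mul, ← hc, RingEquiv.apply_symm_apply]
    refine ⟨φ (r * (α ^ n) c) * θ ^ n, ?_⟩
    rw [mul_assoc _ _ (φ X), skew_comm hS, ← mul_assoc, ← mul_assoc, ← map_mul, ← map_mul]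
    congr 2
    nth_rewrite 1 [h1]; ring

include hX hS in
theorem skew_sep {s : S} (hs : s ≠ 0) : ∃ n, ¬ φ X ^ n ∣ s := by
  by_contra! hcon
  apply hs
  obtain ⟨f, rfl⟩ := (skewEquiv hS).surjective s
  have : f = 0 := by
    ext i
    by_contra hi
    have hXu : ¬ IsUnit X := by
      rw [← mem_nonunits_iff, ← IsLocalRing.mem_maximalIdeal, hX]
      exact Ideal.mem_span_singleton_self X
    obtain ⟨n, hn⟩ := FiniteMultiplicity.of_not_isUnit hXu hi
    apply hn
    obtain ⟨w, hw⟩ := hcon (n + 1)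
    obtain ⟨g, rfl⟩ := (skewEquiv hS).surjective w
    rw [← map_pow, skewEquiv_mul_left] at hw
    rw [(skewEquiv hS).injective hw]
    exact ⟨g i, rfl⟩
  rw [this, map_zero]

include hX hS hα in
theorem skew_domain {T : Type u} [Ring T] {ψ : S →+* T} (hT : IsLocalizationAt (φ X) ψ) :
    NoZeroDivisors S := by
  have fac : ∀ s : S, s ≠ 0 → ∃ n s', s = φ X ^ n * s' ∧ ¬ φ X ∣ s' := by
    intro s hs
    classical
    have hex := skew_sep hX hS hs
    obtain ⟨m, hm⟩ : ∃ m, Nat.find hex = m + 1 := by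
      refine Nat.exists_eq_succ_of_ne_zero fun h0 => ?_
      have := Nat.find_spec hex
      rw [h0] at this
      exact this (by simp)
    have h1 : φ X ^ m ∣ s := not_not.1 (Nat.find_min hex (by omega))
    obtain ⟨s', hs'⟩ := h1
    refine ⟨m, s', hs', ?_⟩
    rintro ⟨w, rfl⟩
    refine Nat.find_spec hex ⟨w, ?_⟩
    rw [hm, hs', pow_succ, mul_assoc]
  refine ⟨fun {a b} hab => ?_⟩
  by_contra! hne
  obtain ⟨m, b', hb, hb'⟩ := fac b hne.2
  obtain ⟨a2, ha2⟩ := core_swap' _ (skewRed_ker hX hS hα) m a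
  have ha20 : a2 ≠ 0 := by
    rintro rfl
    apply hne.1
    apply core_xr hT m
    rw [ha2, mul_zero, zero_mul]
  obtain ⟨n, a', ha, ha'⟩ := fac a2 ha20
  have h1 : a' * b' = 0 := by
    apply core_xl hT n
    apply core_xl hT m
    rw [← mul_assoc, ← mul_assoc, ← mul_assoc, mul_assoc _ _ a', ← ha, ← ha2, mul_assoc, ← hb, hab]
    simp
  have h2 := congrArg (skewRed hS hα) h1
  rw [map_mul, map_zero, mul_eq_zero, skewRed_ker hX, skewRed_ker hX] at h2
  tauto

/-- Elements of degree less than `m`. -/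
def SkewDegLT (φ : R →+* S) (θ : S) (m : ℕ) (s : S) : Prop :=
  ∃ p : ℕ → R, s = ∑ i ∈ Finset.range m, φ (p i) * θ ^ i

theorem SkewDegLT.sub {m : ℕ} {s t : S} (h : SkewDegLT φ θ m s) (h' : SkewDegLT φ θ m t) :
    SkewDegLT φ θ m (s - t) := by
  obtain ⟨p, rfl⟩ := h
  obtain ⟨q, rfl⟩ := h'
  exact ⟨fun i => p i - q i, by simp [sub_mul]⟩

theorem SkewDegLT.mono {m n : ℕ} (hmn : m ≤ n) {s : S} (h : SkewDegLT φ θ m s) :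
    SkewDegLT φ θ n s := by
  induction n, hmn using Nat.le_induction with
  | base => exact h
  | succ n _ ih =>
    obtain ⟨p, rfl⟩ := ih
    refine ⟨fun i => if i < n then p i else 0, ?_⟩
    rw [Finset.sum_range_succ]
    simp only [lt_irrefl, if_false, map_zero, zero_mul, add_zero]
    refine Finset.sum_congr rfl fun i hi => ?_
    rw [if_pos (Finset.mem_range.1 hi)]

include hS in
theorem SkewDegLT.mulC {m : ℕ} {s : S} (h : SkewDegLT φ θ m s) (e : R) :
    SkewDegLT φ θ m (s * φ e) := by
  obtain ⟨p, rfl⟩ := h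
  refine ⟨fun i => p i * (α ^ i) e, ?_⟩
  rw [Finset.sum_mul]
  refine Finset.sum_congr rfl fun i _ => ?_
  rw [mul_assoc, skew_comm hS, map_mul, mul_assoc]

theorem SkewDegLT.mulθ {m : ℕ} {s : S} (h : SkewDegLT φ θ m s) (j : ℕ) :
    SkewDegLT φ θ (m + j) (s * θ ^ j) := by
  induction j with
  | zero => simpa using h
  | succ j ih =>
    obtain ⟨p, hp⟩ := ih
    refine ⟨fun i => if i = 0 then 0 else p (i - 1), ?_⟩
    rw [pow_succ, ← mul_assoc, hp, ← add_assoc, Finset.sum_range_succ', Finset.sum_mul]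
    simp [pow_succ, mul_assoc]

include hS in
theorem skewDegLT_exists (s : S) : ∃ m, SkewDegLT φ θ m s := by
  obtain ⟨f, rfl⟩ := (skewEquiv hS).surjective s
  refine ⟨f.support.sup id + 1, f, ?_⟩
  have h2 : skewEquiv hS f = f.sum fun n r => φ r * θ ^ n := rfl
  rw [h2, Finsupp.sum]
  refine Finset.sum_subset (fun i hi => ?_) fun i _ hi => ?_
  · rw [Finset.mem_range]
    exact Nat.lt_succ_of_le (Finset.le_sup (f := id) hi)
  · rw [Finsupp.notMem_support_iff.1 hi]; simp

include hX hS in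
/-- A set of elements closed under the obvious operations is contained in `dT`
for one of its elements `d`. -/
theorem skew_principal {T : Type u} [Ring T] {ψ : S →+* T} (hT : IsLocalizationAt (φ X) ψ)
    (J : S → Prop) (hsub : ∀ a b, J a → J b → J (a - b)) (hmul : ∀ a s, J a → J (a * s))
    (z : S) (hz : J z) (hz0 : z ≠ 0) : ∃ d, J d ∧ ∀ s, J s → ψ d ∣ ψ s := by
  classical
  have hex : ∃ m, ∃ d, J d ∧ d ≠ 0 ∧ SkewDegLT φ θ m d := by
    obtain ⟨m, hm⟩ := skewDegLT_exists hS z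
    exact ⟨m, z, hz, hz0, hm⟩
  obtain ⟨d, hJd, hd0, p, hd⟩ := Nat.find_spec hex
  have hmin : ∀ m, m < Nat.find hex → ∀ s, J s → SkewDegLT φ θ m s → s = 0 := by
    intro m hm s hs hs'
    by_contra h0
    exact Nat.find_min hex hm ⟨s, hs, h0, hs'⟩
  generalize Nat.find hex = N at hd hmin
  obtain _ | n := N
  · simp [hd] at hd0
  rw [Finset.sum_range_succ] at hd
  set d' := ∑ i ∈ Finset.range n, φ (p i) * θ ^ i with hd'
  have hd'F : SkewDegLT φ θ n d' := ⟨p, hd'⟩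
  have hc : p n ≠ 0 := by
    intro h0
    rw [h0, map_zero, zero_mul, add_zero] at hd
    exact hd0 (hmin n (by omega) d hJd (hd ▸ hd'F))
  refine ⟨d, hJd, ?_⟩
  have key : ∀ m s, SkewDegLT φ θ m s → J s → ψ d ∣ ψ s := by
    intro m
    induction m with
    | zero =>
      rintro s ⟨q, rfl⟩ _
      simp
    | succ m ih =>
      intro s hs hJs
      by_cases hmn : m < n
      · rw [hmin (m + 1) (by omega) s hJs hs, map_zero]; exact dvd_zero _
      obtain ⟨j, rfl⟩ := Nat.exists_eq_add_of_le (not_lt.1 hmn)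
      obtain ⟨q, hq⟩ := hs
      rw [Finset.sum_range_succ] at hq
      set s' := ∑ i ∈ Finset.range (n + j), φ (q i) * θ ^ i with hs'
      have hs'F : SkewDegLT φ θ (n + j) s' := ⟨q, hs'⟩
      obtain ⟨v, g, hg⟩ : ∃ v, (α ^ (n + j)).symm (p n) ∣ X ^ v := by
        have hXirr : Irreducible X :=
          (IsDiscreteValuationRing.irreducible_iff_uniformizer X).2 hX
        have hc' : (α ^ (n + j)).symm (p n) ≠ 0 := by simpa using hc
        obtain ⟨v, hv⟩ := IsDiscreteValuationRing.associated_pow_irreducible hc' hXirr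
        exact ⟨v, hv.dvd⟩
      have hg' : (α ^ (n + j)) (X ^ v) = p n * (α ^ (n + j)) g := by
        rw [hg, map_mul, RingEquiv.apply_symm_apply]
      set e := (α ^ n).symm (q (n + j) * (α ^ (n + j)) g) with he
      have he' : (α ^ n) e = q (n + j) * (α ^ (n + j)) g := RingEquiv.apply_symm_apply _ _
      have h1 : s * φ (X ^ v) - d * (φ e * θ ^ j)
          = s' * φ (X ^ v) - d' * φ e * θ ^ j := by
        have h2 : φ (q (n + j)) * θ ^ (n + j) * φ (X ^ v)
            = φ (p n) * θ ^ n * (φ e * θ ^ j) := by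
          rw [mul_assoc, skew_comm hS, hg', mul_assoc (φ (p n)), ← mul_assoc (θ ^ n),
            skew_comm hS, he', pow_add θ, map_mul, map_mul]
          have h5 : φ (q (n + j)) * φ (p n) = φ (p n) * φ (q (n + j)) := by
            rw [← map_mul, ← map_mul, mul_comm]
          simp only [← mul_assoc]
          rw [h5]
        rw [hq, hd, add_mul, add_mul, h2, ← mul_assoc d']
        abel
      have h3 : ψ d ∣ ψ (s * φ (X ^ v) - d * (φ e * θ ^ j)) := by
        apply ih
        · rw [h1]
          exact (hs'F.mulC hS _).sub ((hd'F.mulC hS _).mulθ j)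
        · exact hsub _ _ (hmul _ _ hJs) (hmul _ _ hJd)
      have h4 : ψ d ∣ ψ s * ψ (φ X) ^ v := by
        rw [← map_pow, ← map_mul, ← map_pow,
          ← sub_add_cancel (s * φ (X ^ v)) (d * (φ e * θ ^ j)), map_add]
        exact dvd_add h3 (map_dvd ψ (dvd_mul_right _ _))
      obtain ⟨w, hw⟩ := h4
      obtain ⟨u, hu⟩ := hT.unit.pow v
      rw [← hu] at hw
      exact ⟨w * (↑u⁻¹ : T), by rw [← mul_assoc, ← hw, mul_assoc, Units.mul_inv, mul_one]⟩
  intro s hs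
  obtain ⟨m, hm⟩ := skewDegLT_exists hS s
  exact key m s hm hs

include hX hS in
theorem skew_max {T : Type u} [Ring T] {ψ : S →+* T} (hT : IsLocalizationAt (φ X) ψ)
    {z : S} (hz : Irreducible (ψ z)) (b : S) (hb : ¬ ψ z ∣ ψ b) :
    ∃ t t', ψ b * t + ψ z * t' = 1 := by
  have hz0 : z ≠ 0 := by
    rintro rfl
    rw [map_zero] at hz
    exact not_irreducible_zero hz
  obtain ⟨d, ⟨t, t', htt⟩, hd⟩ := skew_principal hX hS hT
    (fun s => ∃ t t', ψ b * t + ψ z * t' = ψ s)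
    (by
      rintro a c ⟨t1, t2, h⟩ ⟨t3, t4, h'⟩
      exact ⟨t1 - t3, t2 - t4, by rw [map_sub, ← h, ← h']; noncomm_ring⟩)
    (by
      rintro a s ⟨t1, t2, h⟩
      exact ⟨t1 * ψ s, t2 * ψ s, by rw [map_mul, ← h]; noncomm_ring⟩)
    z ⟨0, 1, by simp⟩ hz0
  obtain ⟨e, he⟩ := hd z ⟨0, 1, by simp⟩
  obtain ⟨g, hg⟩ := hd b ⟨1, 0, by simp⟩
  rcases hz.isUnit_or_isUnit he with ⟨u, hu⟩ | ⟨u, hu⟩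
  · refine ⟨t * (↑u⁻¹ : T), t' * (↑u⁻¹ : T), ?_⟩
    rw [← mul_assoc, ← mul_assoc, ← add_mul, htt, ← hu, Units.mul_inv]
  · exfalso
    apply hb
    refine ⟨(↑u⁻¹ : T) * g, ?_⟩
    rw [he, ← hu, mul_assoc, ← mul_assoc (u : T), Units.mul_inv, one_mul, hg]

end skew

/-- Let `z ∈ S` be a type (B) element irreducible in both `S` and `T`,
and let `y ∈ S∖XS`.  Then the following are equivalent: (a) `S/zS ≅ S/yS` as
`S`-modules; (b) `T/zT ≅ T/yT` as `T`-modules; (c) `z` and `y` are similar in `T`.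
Moreover, when these hold, `y` is a type (B) irreducible element of `S`. -/
theorem typeB_isomorphism_criterion
    {k : Type u} [Field k]
    {R : Type u} [CommRing R] [IsDomain R] [IsDiscreteValuationRing R] [Algebra k R]
    (X : R) (hX : IsLocalRing.maximalIdeal R = Ideal.span {X})
    (hres : Function.Bijective ((IsLocalRing.residue R).comp (algebraMap k R)))
    (α : R ≃ₐ[k] R) (hord : ∀ n : ℕ, 0 < n → α ^ n ≠ 1)
    {S : Type u} [Ring S] (φ : R →+* S) (θ : S)
    (hS : IsSkewPolynomialRing α.toRingEquiv φ θ)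
    {T : Type u} [Ring T] (ψ : S →+* T) (hT : IsLocalizationAt (φ X) ψ)
    (z y : S) (hz : Irreducible z) (hzT : Irreducible (ψ z)) (hzB : IsTypeB X φ z)
    (hy : ¬ ∃ s : S, y = φ X * s) :
    (Nonempty (rQuot S z ≃ₗ[Sᵐᵒᵖ] rQuot S y) ↔
      Nonempty (rQuot T (ψ z) ≃ₗ[Tᵐᵒᵖ] rQuot T (ψ y))) ∧
    (Nonempty (rQuot T (ψ z) ≃ₗ[Tᵐᵒᵖ] rQuot T (ψ y)) ↔ SimilarIn T (ψ z) (ψ y)) ∧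
    (Nonempty (rQuot S z ≃ₗ[Sᵐᵒᵖ] rQuot S y) → Irreducible y ∧ IsTypeB X φ y) := by

  have hα : ∀ r, IsLocalRing.residue R (α.toRingEquiv r) = IsLocalRing.residue R r := by
    intro r
    obtain ⟨c, hc⟩ := hres.2 (IsLocalRing.residue R r)
    rw [RingHom.comp_apply] at hc
    have h1 : X ∣ r - algebraMap k R c := by
      rw [skew_X_dvd_iff hX, map_sub, hc, sub_self]
    have h2 : X ∣ α.toRingEquiv (r - algebraMap k R c) :=
      (skew_dvd_aut hX α.toRingEquiv).trans (map_dvd α.toRingEquiv h1)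
    have h3 : α.toRingEquiv (algebraMap k R c) = algebraMap k R c := α.commutes c
    rw [skew_X_dvd_iff hX, map_sub, h3, map_sub, hc, sub_eq_zero] at h2
    exact h2
  set π := skewRed hS hα with hπdef
  have hπ : ∀ s, π s = 0 ↔ φ X ∣ s := skewRed_ker hX hS hα
  have hx := skew_normal hX hS
  have hdom := skew_domain hX hS hα hT
  have hyx : ¬ φ X ∣ y := hy
  have hnt : Nontrivial S := ⟨⟨z, 0, hz.ne_zero⟩⟩
  have hxu : ¬ φ X ∣ 1 := by rw [← hπ, map_one]; exact one_ne_zero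
  have hunit : ∀ a b : S, a * b = 1 → IsUnit a := by
    intro a b hab
    refine ⟨⟨a, b, hab, ?_⟩, rfl⟩
    have ha : a ≠ 0 := by rintro rfl; simp at hab
    have h0 : a * (b * a - 1) = 0 := by rw [mul_sub, ← mul_assoc, hab]; simp
    exact sub_eq_zero.1 ((mul_eq_zero.1 h0).resolve_left ha)
  obtain ⟨c, d, hzc⟩ : ∃ c d, z * c + φ X * d = 1 := by
    obtain ⟨u, s, -, hu⟩ := hzB
    have h1 : φ X ∣ 1 - z * u := by
      have h2 : (u : S) * (1 - z * u) = - (φ X * (s * u)) := by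
        rw [mul_sub, ← mul_assoc, hu]; noncomm_ring
      have h3 : π (u : S) * π (1 - z * u) = 0 := by
        rw [← map_mul, h2, hπ, dvd_neg]; exact dvd_mul_right _ _
      rw [← hπ]
      exact (mul_eq_zero.1 h3).resolve_left (u.isUnit.map π).ne_zero
    obtain ⟨d, hd⟩ := h1
    exact ⟨u, d, by rw [← hd]; abel⟩
  have hzx : ¬ φ X ∣ z := fun h => hxu (by
    rw [← hzc]; exact dvd_add (h.mul_right _) (dvd_mul_right _ _))
  have hmax := skew_max hX hS hT hzT
  have hz1 : ¬ z ∣ 1 := by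
    rintro ⟨w, hw⟩
    exact hz.not_isUnit (hunit z w hw.symm)
  have hzu : ¬ ψ z ∣ 1 := by
    rw [← map_one ψ, core_contract hT π hπ hx hzx]; exact hz1
  refine ⟨?_, Iff.rfl, ?_⟩
  · rw [rQuot_iso_iff, rQuot_iso_iff]
    exact core_iso hT π hπ hx hzc hzx hyx hmax hzu
  · rw [rQuot_iso_iff]
    intro hiso
    obtain ⟨⟨c', d', hyc⟩, hymax⟩ :=
      core_type π hπ hzc (core_max hT π hπ hx hzc hzx hmax) hiso
    have hy1 : ¬ IsUnit y := by
      rintro ⟨v, hv⟩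
      obtain ⟨a, ha, -⟩ := hiso
      apply hz1
      rw [← ha]
      exact ⟨(↑v⁻¹ : S) * (a * 1), by rw [← hv, ← mul_assoc, Units.mul_inv, one_mul]⟩
    have hy0 : y ≠ 0 := by rintro rfl; exact hyx (dvd_zero _)
    refine ⟨⟨hy1, ?_⟩, ?_⟩
    · intro a b hab
      by_cases hya : y ∣ a
      · right
        obtain ⟨w, hw⟩ := hya
        have ha : a ≠ 0 := by rintro rfl; simp at hab; exact hy0 hab
        have h0 : a * (b * w - 1) = 0 := by
          rw [mul_sub, ← mul_assoc, ← hab, ← hw]; simp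
        exact hunit b w (sub_eq_zero.1 ((mul_eq_zero.1 h0).resolve_left ha))
      · left
        obtain ⟨e, w, hew⟩ := hymax a hya
        refine hunit a (e + b * w) ?_
        rw [← hew]; rw [mul_add, ← mul_assoc, ← hab]
    · have h1 : π y * π c' = 1 := by
        rw [← map_mul, eq_comm, ← map_one π, ← hyc, map_add, (hπ (φ X * d')).2 (dvd_mul_right _ _),
          add_zero]
      obtain ⟨q, hq, hq'⟩ := Polynomial.isUnit_iff.1 (IsUnit.of_mul_eq_one _ h1)
      obtain ⟨r, rfl⟩ := IsLocalRing.residue_surjective q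
      have hr : IsUnit r := by
        by_contra hr
        have : IsLocalRing.residue R r = 0 := by
          rw [IsLocalRing.residue_eq_zero_iff, IsLocalRing.mem_maximalIdeal]; exact hr
        rw [this] at hq
        exact not_isUnit_zero hq
      obtain ⟨v, rfl⟩ := hr
      have h2 : φ X ∣ y - φ v := by
        rw [← hπ, map_sub, ← hq', hπdef, skewRed_C, sub_self]
      obtain ⟨s, hs⟩ := h2
      have hs' : y = φ v + φ X * s := by rw [← hs]; abel
      have hv : φ (↑v⁻¹ : R) * φ (v : R) = 1 := by rw [← map_mul]; simp
      have hfin : φ (↑v⁻¹ : R) * y = 1 + φ X * (φ (↑v⁻¹ : R) * s) := by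
        rw [hs', mul_add, hv, ← mul_assoc, ← mul_assoc, ← map_mul, ← map_mul, mul_comm X]
      refine ⟨Units.map φ.toMonoidHom v⁻¹, φ (↑v⁻¹ : R) * s, ?_, hfin⟩
      rintro ⟨r', hr'⟩
      rw [← hr', ← map_mul, ← map_one φ, ← map_add] at hfin
      have hu : IsUnit (1 + X * r') := by
        by_contra hn
        rw [← mem_nonunits_iff, ← IsLocalRing.mem_maximalIdeal, hX, Ideal.mem_span_singleton] at hn
        have h5 : X ∣ 1 := (dvd_add_left (dvd_mul_right X r')).1 hn
        exact hxu (by simpa using map_dvd φ h5)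
      apply hy1
      have h6 : IsUnit (φ (↑v⁻¹ : R) * y) := by rw [hfin]; exact hu.map φ
      have h7 : y = φ v * (φ (↑v⁻¹ : R) * y) := by
        rw [← mul_assoc, ← map_mul]; simp
      rw [h7]
      exact (v.isUnit.map φ).mul h6
end

section
/- The simple right S-modules that are not faithful are exactly the 𝒳-torsion simple modules V_f := S/(XS + fS), where f ranges over the monic irreducible polynomials of k[θ]; moreover V_f ≅ V_g if and only if f = g. -/
open MulOpposite

universe u

namespace UnfaithfulAux

open Polynomial

section

variable {R S : Type u} [CommRing R] [Ring S] {α : R ≃+* R} {φ : R →+* S} {θ : S}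

/-- The additive bijection between coefficient sequences and `S`. -/
noncomputable def coeffEquiv (hS : IsSkewPolynomialRing α φ θ) : (ℕ →₀ R) ≃+ S :=
  AddEquiv.ofBijective
    (Finsupp.liftAddHom (fun n : ℕ =>
      ((AddMonoidHom.mulRight (θ ^ n)).comp φ.toAddMonoidHom : R →+ S))) hS.bijective

lemma coeffEquiv_apply (hS : IsSkewPolynomialRing α φ θ) (a : ℕ →₀ R) :
    coeffEquiv hS a = a.sum fun n r => φ r * θ ^ n := rfl

lemma coeffEquiv_single (hS : IsSkewPolynomialRing α φ θ) (n : ℕ) (r : R) :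
    coeffEquiv hS (Finsupp.single n r) = φ r * θ ^ n := by
  rw [coeffEquiv_apply, Finsupp.sum_single_index]
  simp

lemma skew_induction (hS : IsSkewPolynomialRing α φ θ) {P : S → Prop} (s : S) (h0 : P 0)
    (hadd : ∀ a b, P a → P b → P (a + b)) (hm : ∀ n r, P (φ r * θ ^ n)) : P s := by
  obtain ⟨a, rfl⟩ := (coeffEquiv hS).surjective s
  induction a using Finsupp.induction_linear with
  | zero => simpa using h0
  | add f g hf hg => rw [map_add]; exact hadd _ _ hf hg
  | single n r => rw [coeffEquiv_single]; exact hm n r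

lemma theta_pow_mul (hS : IsSkewPolynomialRing α φ θ) (n : ℕ) (r : R) :
    θ ^ n * φ r = φ ((α ^ n) r) * θ ^ n := by
  induction n generalizing r with
  | zero => simp
  | succ n ih =>
    rw [pow_succ, mul_assoc, hS.commutes, ← mul_assoc, ih, mul_assoc, pow_succ]
    rfl

lemma phi_injective (hS : IsSkewPolynomialRing α φ θ) : Function.Injective φ := by
  intro a b h
  have : coeffEquiv hS (Finsupp.single 0 a) = coeffEquiv hS (Finsupp.single 0 b) := by
    simp [coeffEquiv_single, h]
  exact Finsupp.single_injective 0 ((coeffEquiv hS).injective this)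

lemma mul_theta (hS : IsSkewPolynomialRing α φ θ) (s : S) : ∃ s', s * θ = θ * s' := by
  refine skew_induction hS (P := fun s => ∃ s', s * θ = θ * s') s ⟨0, by simp⟩ ?_ ?_
  · rintro a b ⟨a', ha⟩ ⟨b', hb⟩
    exact ⟨a' + b', by rw [add_mul, mul_add, ha, hb]⟩
  · intro n r
    refine ⟨φ (α.symm r) * θ ^ n, ?_⟩
    rw [← mul_assoc, hS.commutes, RingEquiv.apply_symm_apply, mul_assoc, mul_assoc, ← pow_succ,
      ← pow_succ']

lemma decomp_theta (hS : IsSkewPolynomialRing α φ θ) (s : S) :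
    ∃ r s', s = φ r + s' * θ := by
  refine skew_induction hS (P := fun s => ∃ r s', s = φ r + s' * θ) s ⟨0, 0, by simp⟩ ?_ ?_
  · rintro a b ⟨r, a', ha⟩ ⟨r', b', hb⟩
    exact ⟨r + r', a' + b', by rw [ha, hb, map_add, add_mul]; abel⟩
  · rintro (_ | n) r
    · exact ⟨r, 0, by simp⟩
    · exact ⟨0, φ r * θ ^ n, by rw [pow_succ]; simp [mul_assoc]⟩

lemma kill_or_inj {V : Type u} [AddCommGroup V] [Module Sᵐᵒᵖ V] [IsSimpleModule Sᵐᵒᵖ V]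
    (z : S) (hz : ∀ s, ∃ s', s * z = z * s') :
    (∀ v : V, op z • v = 0) ∨ (∀ v : V, op z • v = 0 → v = 0) := by
  let K : Submodule Sᵐᵒᵖ V :=
    { carrier := {v | op z • v = 0}
      zero_mem' := by simp
      add_mem' := by
        intro a b ha hb
        simp only [Set.mem_ofPred_eq] at *
        rw [smul_add, ha, hb, add_zero]
      smul_mem' := by
        intro c v hv
        simp only [Set.mem_ofPred_eq] at *
        obtain ⟨s', hs'⟩ := hz c.unop
        have : op z * c = op s' * op z := by
          rw [← op_mul, ← hs', op_mul, op_unop]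
        rw [smul_smul, this, mul_smul, hv, smul_zero] }
  rcases eq_bot_or_eq_top K with h | h
  · right
    intro v hv
    have : v ∈ K := hv
    rwa [h, Submodule.mem_bot] at this
  · left
    intro v
    have : v ∈ K := h ▸ Submodule.mem_top
    exact this

/-- Some term `r θ^i` with `r ≠ 0` kills `V`. -/
lemma exists_monomial [IsDomain R] (hS : IsSkewPolynomialRing α φ θ)
    (hord : ∀ n : ℕ, 0 < n → α ^ n ≠ 1)
    {V : Type u} [AddCommGroup V] [Module Sᵐᵒᵖ V] (N : ℕ) :
    ∀ a : ℕ →₀ R, a.support.card ≤ N → a ≠ 0 → (∀ v : V, op (coeffEquiv hS a) • v = 0) →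
      ∃ (r : R) (i : ℕ), r ≠ 0 ∧ ∀ v : V, op (φ r * θ ^ i) • v = 0 := by
  induction N with
  | zero =>
    intro a ha ha0
    exact absurd (by simpa using ha) ha0
  | succ N ih =>
    intro a ha ha0 hk
    obtain ⟨i, hi⟩ := Finsupp.support_nonempty_iff.mpr ha0
    by_cases hs : a.support = {i}
    · refine ⟨a i, i, by simpa using hi, ?_⟩
      rw [Finsupp.support_eq_singleton] at hs
      rw [hs.2, coeffEquiv_single] at hk
      exact hk
    · obtain ⟨j, hj, hji⟩ : ∃ j ∈ a.support, j ≠ i := by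
        by_contra! hcon
        exact hs (Finset.eq_singleton_iff_unique_mem.mpr ⟨hi, hcon⟩)
      have hne : ∃ r, (α ^ i) r ≠ (α ^ j) r := by
        by_contra! hcon
        have h1 : α ^ i = α ^ j := RingEquiv.ext hcon
        rcases lt_or_gt_of_ne hji with h | h
        · refine hord (i - j) (by omega) ?_
          rw [← Nat.sub_add_cancel h.le, pow_add] at h1
          exact mul_eq_right.mp h1
        · refine hord (j - i) (by omega) ?_
          rw [← Nat.sub_add_cancel h.le, pow_add] at h1
          exact mul_eq_right.mp h1.symm
      obtain ⟨r, hr⟩ := hne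
      let b : ℕ →₀ R := Finsupp.onFinset a.support
        (fun l => a l * ((α ^ i) r - (α ^ l) r)) (by
          intro l hl
          rw [Finsupp.mem_support_iff]
          exact left_ne_zero_of_mul hl)
      have hb : ∀ l, b l = a l * ((α ^ i) r - (α ^ l) r) := fun l => rfl
      have hbsub : b.support ⊆ a.support.erase i := by
        intro l hl
        rw [Finsupp.mem_support_iff, hb] at hl
        rw [Finset.mem_erase, Finsupp.mem_support_iff]
        refine ⟨?_, left_ne_zero_of_mul hl⟩
        rintro rfl
        simp at hl
      have hE : coeffEquiv hS b = φ ((α ^ i) r) * coeffEquiv hS a - coeffEquiv hS a * φ r := by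
        rw [coeffEquiv_apply, coeffEquiv_apply,
          Finsupp.sum_of_support_subset b (hbsub.trans (Finset.erase_subset _ _)) _ (by simp),
          Finsupp.sum, Finset.mul_sum, Finset.sum_mul, ← Finset.sum_sub_distrib]
        refine Finset.sum_congr rfl fun l _ => ?_
        rw [mul_assoc (φ (a l)), theta_pow_mul hS, hb, ← mul_assoc, ← mul_assoc, ← map_mul,
          ← map_mul, ← sub_mul, ← map_sub]
        congr 2
        ring
      refine ih b ?_ ?_ ?_
      · have h1 := Finset.card_le_card hbsub
        rw [Finset.card_erase_of_mem hi] at h1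
        omega
      · intro h0
        have := hb j
        rw [h0] at this
        exact mul_ne_zero (Finsupp.mem_support_iff.mp hj) (sub_ne_zero.mpr hr) this.symm
      · intro v
        rw [hE, op_sub, op_mul, op_mul, sub_smul, mul_smul, mul_smul, hk, hk, smul_zero, sub_zero]

end

section

variable {k : Type u} [Field k] {R : Type u} [CommRing R] [IsDomain R]
  [IsDiscreteValuationRing R] [Algebra k R] {X : R}
  {α : R ≃ₐ[k] R} {S : Type u} [Ring S] {φ : R →+* S} {θ : S}

lemma exists_res (hX : IsLocalRing.maximalIdeal R = Ideal.span {X})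
    (hres : Function.Bijective ((IsLocalRing.residue R).comp (algebraMap k R))) :
    ∃ ρ : R →+* k, (∀ c, ρ (algebraMap k R c) = c) ∧ ∀ r, ρ r = 0 ↔ X ∣ r := by
  let e := RingEquiv.ofBijective _ hres
  refine ⟨(e.symm : _ →+* k).comp (IsLocalRing.residue R), fun c => ?_, fun r => ?_⟩
  · exact e.symm_apply_apply c
  · rw [← Ideal.mem_span_singleton, ← hX, ← IsLocalRing.residue_eq_zero_iff]
    exact EmbeddingLike.map_eq_zero_iff (f := e.symm)

lemma exists_pi (hX : IsLocalRing.maximalIdeal R = Ideal.span {X})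
    (hres : Function.Bijective ((IsLocalRing.residue R).comp (algebraMap k R)))
    (hS : IsSkewPolynomialRing α.toRingEquiv φ θ) :
    ∃ π : S →+* k[X], (∀ p, π (thetaPoly φ θ p) = p) ∧
      (∀ s, π s = 0 ↔ ∃ s', s = φ X * s') := by
  obtain ⟨ρ, hρ, hρ0⟩ := exists_res hX hres
  have hρα : ∀ r, ρ (α r) = ρ r := by
    intro r
    obtain ⟨t, ht⟩ : X ∣ r - algebraMap k R (ρ r) := by
      rw [← hρ0, map_sub, hρ, sub_self]
    have hXm : ρ (α X) = 0 := by
      rw [hρ0, ← Ideal.mem_span_singleton, ← hX, IsLocalRing.mem_maximalIdeal, mem_nonunits_iff]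
      intro hu
      have hu' : IsUnit X := by
        have := hu.map α.symm
        simpa using this
      have hm : X ∈ IsLocalRing.maximalIdeal R := hX ▸ Ideal.mem_span_singleton_self X
      exact hm hu'
    rw [sub_eq_iff_eq_add] at ht
    have h2 : ρ (α r) = ρ (α (X * t + algebraMap k R (ρ r))) := congrArg (fun x => ρ (α x)) ht
    rw [h2, map_add, map_mul, map_add, map_mul, hXm, zero_mul, zero_add, AlgEquiv.commutes, hρ]
  have hραn : ∀ (n : ℕ) r, ρ ((α.toRingEquiv ^ n) r) = ρ r := by
    intro n
    induction n with
    | zero => intro r; simp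
    | succ n ih =>
      intro r
      rw [pow_succ]
      exact (ih _).trans (hρα r)
  let P0 : (ℕ →₀ R) →+ k[X] := Finsupp.liftAddHom fun n =>
    ((monomial n : k →ₗ[k] k[X]).toAddMonoidHom.comp ρ.toAddMonoidHom)
  have hP0 : ∀ n r, P0 (Finsupp.single n r) = monomial n (ρ r) := by
    intro n r
    simp [P0]
  have hP0c : ∀ a n, (P0 a).coeff n = ρ (a n) := by
    intro a n
    induction a using Finsupp.induction_linear with
    | zero => simp
    | add f g hf hg => simp [hf, hg]
    | single m r =>
      rw [hP0, coeff_monomial, Finsupp.single_apply]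
      split_ifs <;> simp
  let E := coeffEquiv hS
  let π0 : S →+ k[X] := P0.comp E.symm.toAddMonoidHom
  have hπ0 : ∀ n r, π0 (φ r * θ ^ n) = monomial n (ρ r) := by
    intro n r
    rw [← coeffEquiv_single hS, ← hP0]
    exact congrArg P0 (E.symm_apply_apply _)
  have h1 : π0 1 = 1 := by
    have := hπ0 0 1
    simpa using this
  have hmul : ∀ a b, π0 (a * b) = π0 a * π0 b := by
    intro a b
    refine skew_induction hS (P := fun a => π0 (a * b) = π0 a * π0 b) a (by simp) ?_ ?_
    · intro x y hx hy
      rw [add_mul, map_add, map_add, hx, hy, add_mul]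
    · intro n r
      refine skew_induction hS
        (P := fun b => π0 (φ r * θ ^ n * b) = π0 (φ r * θ ^ n) * π0 b) b (by simp) ?_ ?_
      · intro x y hx hy
        rw [mul_add, map_add, map_add, hx, hy, mul_add]
      · intro m r'
        have : φ r * θ ^ n * (φ r' * θ ^ m)
            = φ (r * (α.toRingEquiv ^ n) r') * θ ^ (n + m) := by
          rw [mul_assoc, ← mul_assoc (θ ^ n), theta_pow_mul hS, map_mul, pow_add]
          simp only [mul_assoc]
        rw [this, hπ0, hπ0, hπ0, monomial_mul_monomial, map_mul, hραn]
  refine ⟨{ π0 with map_one' := h1, map_mul' := hmul }, ?_, ?_⟩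
  · intro p
    change π0 (thetaPoly φ θ p) = p
    rw [thetaPoly, Polynomial.sum, map_sum]
    simp only [hπ0, hρ]
    exact p.sum_monomial_eq
  · intro s
    change π0 s = 0 ↔ _
    constructor
    · intro h
      obtain ⟨a, rfl⟩ := E.surjective s
      have h' : P0 a = 0 := by
        rw [← h]
        exact (congrArg P0 (E.symm_apply_apply a)).symm
      have hd : ∀ n, ∃ t, a n = X * t := by
        intro n
        refine (hρ0 (a n)).mp ?_
        rw [← hP0c, h', coeff_zero]
      choose t ht using hd
      refine ⟨∑ n ∈ a.support, φ (t n) * θ ^ n, ?_⟩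
      change coeffEquiv hS a = _
      rw [coeffEquiv_apply, Finsupp.sum, Finset.mul_sum]
      refine Finset.sum_congr rfl fun n _ => ?_
      rw [← mul_assoc, ← map_mul, ← ht]
    · rintro ⟨s', rfl⟩
      have := hπ0 0 X
      rw [pow_zero, mul_one, (hρ0 X).mpr dvd_rfl, map_zero] at this
      rw [hmul, this, zero_mul]

lemma X_kills (hX : IsLocalRing.maximalIdeal R = Ideal.span {X})
    (hord : ∀ n : ℕ, 0 < n → α ^ n ≠ 1)
    (hS : IsSkewPolynomialRing α.toRingEquiv φ θ)
    (hXn : ∀ s, ∃ s', s * φ X = φ X * s')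
    (V : Type u) [AddCommGroup V] [Module Sᵐᵒᵖ V] [IsSimpleModule Sᵐᵒᵖ V]
    (hV : ¬ FaithfulSMul Sᵐᵒᵖ V) (v : V) : op (φ X) • v = 0 := by
  have hord' : ∀ n : ℕ, 0 < n → α.toRingEquiv ^ n ≠ 1 := by
    intro n hn h
    refine hord n hn (AlgEquiv.ext fun r => ?_)
    have hp : ∀ (m : ℕ) (r : R), (α ^ m) r = (α.toRingEquiv ^ m) r := by
      intro m
      induction m with
      | zero => intro r; simp
      | succ m ih => intro r; rw [pow_succ, pow_succ]; exact ih _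
    rw [hp, h]
    rfl
  have hnt : Nontrivial V := IsSimpleModule.nontrivial Sᵐᵒᵖ V
  obtain ⟨w, hw⟩ := exists_ne (0 : V)
  rcases kill_or_inj (V := V) (φ X) hXn with h | hXinj
  · exact h v
  exfalso
  rcases kill_or_inj (V := V) θ (mul_theta hS) with hθ | hθinj
  · have hne : op (φ X) • w ≠ 0 := fun h => hw (hXinj w h)
    obtain ⟨s, hs⟩ := (IsSimpleModule.toSpanSingleton_surjective Sᵐᵒᵖ hne) w
    obtain ⟨r, s', hrs⟩ := decomp_theta hS s.unop
    have hs' : s = op (φ r) + op θ * op s' := by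
      rw [← op_mul, ← op_add, ← hrs, op_unop]
    rw [LinearMap.toSpanSingleton_apply, hs', add_smul, mul_smul (op θ), hθ, add_zero, smul_smul,
      ← op_mul, ← map_mul] at hs
    have hu : IsUnit (1 - X * r) := by
      by_contra hc
      have h1 : 1 - X * r ∈ IsLocalRing.maximalIdeal R := hc
      have h2 : X * r ∈ IsLocalRing.maximalIdeal R :=
        hX ▸ Ideal.mul_mem_right _ _ (Ideal.mem_span_singleton_self X)
      have h3 := Ideal.add_mem _ h1 h2
      rw [sub_add_cancel] at h3
      exact h3 isUnit_one
    have h0 : op (φ (1 - X * r)) • w = 0 := by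
      rw [map_sub, map_one, op_sub, sub_smul, hs, op_one, one_smul, sub_self]
    have hu2 : IsUnit (op (φ (1 - X * r))) := (hu.map φ).op
    exact hw ((hu2.smul_eq_zero).mp h0)
  · obtain ⟨c, hc, hck⟩ : ∃ c : S, c ≠ 0 ∧ ∀ v : V, op c • v = 0 := by
      by_contra! hcon
      refine hV ⟨fun {a b} hab => ?_⟩
      by_contra hne
      obtain ⟨v, hv⟩ := hcon (a - b).unop (by
        rw [Ne, unop_eq_zero_iff, sub_eq_zero]; exact hne)
      rw [op_unop, sub_smul, hab, sub_self] at hv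
      exact hv rfl
    obtain ⟨a, rfl⟩ := (coeffEquiv hS).surjective c
    obtain ⟨r, i, hr, hk⟩ := exists_monomial hS hord' (V := V) _ a le_rfl
      (by rintro rfl; simp at hc) hck
    have hθi : ∀ (n : ℕ) (v : V), op (θ ^ n) • v = 0 → v = 0 := by
      intro n
      induction n with
      | zero => intro v hv; simpa using hv
      | succ n ih =>
        intro v hv
        rw [pow_succ, op_mul, mul_smul] at hv
        exact ih _ (hθinj _ hv)
    have hXi : ∀ (n : ℕ) (v : V), op (φ X ^ n) • v = 0 → v = 0 := by
      intro n
      induction n with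
      | zero => intro v hv; simpa using hv
      | succ n ih =>
        intro v hv
        rw [pow_succ, op_mul, mul_smul] at hv
        exact ih _ (hXinj _ hv)
    have hirr : Irreducible X := (IsDiscreteValuationRing.irreducible_iff_uniformizer X).mpr hX
    obtain ⟨n, u, hu⟩ := IsDiscreteValuationRing.eq_unit_mul_pow_irreducible hr hirr
    have h0 := hk w
    rw [op_mul, mul_smul] at h0
    have h1 := hθi _ _ h0
    rw [hu, map_mul, map_pow, op_mul, mul_smul] at h1
    have h2 := hXi _ _ h1
    have hu2 : IsUnit (op (φ (u : R))) := (u.isUnit.map φ).op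
    exact hw ((hu2.smul_eq_zero).mp h2)

end

end UnfaithfulAux

/-- The simple right `S`-modules that are not faithful are exactly the
`𝒳`-torsion simple modules `V_f := S/(XS + fS)`, `f` ranging over the monic irreducible
polynomials of `k[θ]`; moreover `V_f ≅ V_g` iff `f = g`. -/
theorem unfaithful_simple_modules_classification
    {k : Type u} [Field k]
    {R : Type u} [CommRing R] [IsDomain R] [IsDiscreteValuationRing R] [Algebra k R]
    (X : R) (hX : IsLocalRing.maximalIdeal R = Ideal.span {X})
    (hres : Function.Bijective ((IsLocalRing.residue R).comp (algebraMap k R)))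
    (α : R ≃ₐ[k] R) (hord : ∀ n : ℕ, 0 < n → α ^ n ≠ 1)
    {S : Type u} [Ring S] (φ : R →+* S) (θ : S)
    (hS : IsSkewPolynomialRing α.toRingEquiv φ θ)
    {T : Type u} [Ring T] (ψ : S →+* T) (hT : IsLocalizationAt (φ X) ψ) :
    (∀ p : Polynomial k, p.Monic → Irreducible p →
      IsSimpleModule Sᵐᵒᵖ (rQuot2 S (φ X) (thetaPoly φ θ p)) ∧
      ¬ FaithfulSMul Sᵐᵒᵖ (rQuot2 S (φ X) (thetaPoly φ θ p)) ∧
      IsXTorsion (φ X) (rQuot2 S (φ X) (thetaPoly φ θ p))) ∧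
    (∀ (V : Type u) [AddCommGroup V] [Module Sᵐᵒᵖ V],
      IsSimpleModule Sᵐᵒᵖ V → ¬ FaithfulSMul Sᵐᵒᵖ V →
      ∃ p : Polynomial k, p.Monic ∧ Irreducible p ∧
        Nonempty (V ≃ₗ[Sᵐᵒᵖ] rQuot2 S (φ X) (thetaPoly φ θ p))) ∧
    (∀ p q : Polynomial k, p.Monic → Irreducible p → q.Monic → Irreducible q →
      (Nonempty (rQuot2 S (φ X) (thetaPoly φ θ p) ≃ₗ[Sᵐᵒᵖ]
        rQuot2 S (φ X) (thetaPoly φ θ q)) ↔ p = q)) := by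
  classical
  obtain ⟨π, hπτ, hπ0⟩ := UnfaithfulAux.exists_pi hX hres hS
  have hπX : π (φ X) = 0 := (hπ0 _).mpr ⟨1, by simp⟩
  have hXn : ∀ s, ∃ s', s * φ X = φ X * s' := by
    intro s
    exact (hπ0 _).mp (by rw [map_mul, hπX, mul_zero])
  have hXmul : ∀ (J : Submodule Sᵐᵒᵖ S), φ X ∈ J → ∀ s, π s = 0 → s ∈ J := by
    intro J hJ s hs
    obtain ⟨s', rfl⟩ := (hπ0 s).mp hs
    exact J.smul_mem (op s') hJ
  have hmem : ∀ (p : Polynomial k) (s : S),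
      s ∈ rSpan S (φ X) ⊔ rSpan S (thetaPoly φ θ p) ↔ p ∣ π s := by
    intro p s
    constructor
    · intro h
      obtain ⟨a, ha, b, hb, rfl⟩ := Submodule.mem_sup.mp h
      obtain ⟨a', rfl⟩ := Submodule.mem_span_singleton.mp ha
      obtain ⟨b', rfl⟩ := Submodule.mem_span_singleton.mp hb
      rw [MulOpposite.smul_eq_mul_unop, MulOpposite.smul_eq_mul_unop, map_add, map_mul, map_mul,
        hπX, zero_mul, zero_add, hπτ]
      exact dvd_mul_right _ _
    · rintro ⟨g, hg⟩
      have h1 : thetaPoly φ θ p * thetaPoly φ θ g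
          ∈ rSpan S (φ X) ⊔ rSpan S (thetaPoly φ θ p) :=
        Submodule.smul_mem _ (op (thetaPoly φ θ g))
          (Submodule.mem_sup_right (Submodule.mem_span_singleton_self _))
      have h2 : s - thetaPoly φ θ p * thetaPoly φ θ g
          ∈ rSpan S (φ X) ⊔ rSpan S (thetaPoly φ θ p) := by
        refine hXmul _ (Submodule.mem_sup_left (Submodule.mem_span_singleton_self _)) _ ?_
        rw [map_sub, map_mul, hπτ, hπτ, hg, sub_self]
      have := Submodule.add_mem _ h2 h1
      rwa [sub_add_cancel] at this
  have hact : ∀ (p : Polynomial k) (z : S), p ∣ π z →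
      ∀ m : rQuot2 S (φ X) (thetaPoly φ θ p), op z • m = 0 := by
    intro p z hz m
    obtain ⟨s, rfl⟩ := Submodule.mkQ_surjective _ m
    rw [← map_smul, Submodule.mkQ_apply, Submodule.Quotient.mk_eq_zero, hmem,
      op_smul_eq_mul, map_mul]
    exact Dvd.dvd.mul_left hz _
  have hcoatom : ∀ p : Polynomial k, Irreducible p →
      IsCoatom (rSpan S (φ X) ⊔ rSpan S (thetaPoly φ θ p)) := by
    intro p hp
    constructor
    · intro h
      have h1 : (1 : S) ∈ rSpan S (φ X) ⊔ rSpan S (thetaPoly φ θ p) := h ▸ Submodule.mem_top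
      rw [hmem, map_one] at h1
      exact hp.not_isUnit (isUnit_of_dvd_one h1)
    · intro N hN
      obtain ⟨hle, s, hsN, hs⟩ := SetLike.lt_iff_le_and_exists.mp hN
      rw [hmem] at hs
      obtain ⟨a, b, hab⟩ := (hp.coprime_iff_not_dvd).mpr hs
      have h1 : 1 - s * thetaPoly φ θ b ∈ N := by
        apply hle
        rw [hmem, map_sub, map_one, map_mul, hπτ, ← hab]
        exact ⟨a, by ring⟩
      have h2 : s * thetaPoly φ θ b ∈ N := N.smul_mem (op (thetaPoly φ θ b)) hsN
      have h3 := N.add_mem h1 h2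
      rw [sub_add_cancel] at h3
      rw [eq_top_iff]
      intro x _
      have := N.smul_mem (op x) h3
      simpa using this
  have hX0 : X ≠ 0 := by
    rintro rfl
    have h1 : IsLocalRing.maximalIdeal R = ⊥ := by
      rw [hX]
      exact Ideal.span_singleton_eq_bot.mpr rfl
    exact IsDiscreteValuationRing.not_a_field R h1
  refine ⟨?_, ?_, ?_⟩
  · intro p _ hp
    refine ⟨isSimpleModule_iff_isCoatom.mpr (hcoatom p hp), ?_, ?_⟩
    · intro hf
      have h1 : op (φ X) = (0 : Sᵐᵒᵖ) := by
        refine hf.eq_of_smul_eq_smul (α := rQuot2 S (φ X) (thetaPoly φ θ p)) fun m => ?_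
        rw [hact p (φ X) (by rw [hπX]; exact dvd_zero _) m, zero_smul]
      rw [op_eq_zero_iff] at h1
      exact hX0 (UnfaithfulAux.phi_injective hS (by rw [h1, map_zero]))
    · intro m
      exact ⟨1, by rw [pow_one]; exact hact p (φ X) (by rw [hπX]; exact dvd_zero _) m⟩
  · intro V _ _ hV hf
    obtain ⟨v, hv⟩ := @exists_ne V (IsSimpleModule.nontrivial Sᵐᵒᵖ V) 0
    have hk := UnfaithfulAux.X_kills hX hord hS hXn V hf
    let F : S →ₗ[Sᵐᵒᵖ] V :=
      { toFun := fun s => op s • v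
        map_add' := fun a b => by rw [op_add, add_smul]
        map_smul' := fun c s => by
          rw [MulOpposite.smul_eq_mul_unop, op_mul, op_unop, mul_smul, RingHom.id_apply] }
    have hF : ∀ s, F s = op s • v := fun s => rfl
    have hFs : Function.Surjective F := by
      intro w
      obtain ⟨s, hs⟩ := (IsSimpleModule.toSpanSingleton_surjective Sᵐᵒᵖ hv) w
      exact ⟨s.unop, hs⟩
    have hXF : φ X ∈ LinearMap.ker F := by
      rw [LinearMap.mem_ker, hF, hk]
    let e := F.quotKerEquivOfSurjective hFs
    have hco : IsCoatom (LinearMap.ker F) :=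
      isSimpleModule_iff_isCoatom.mp (IsSimpleModule.congr e)
    let J' : Ideal (Polynomial k) :=
      { carrier := {p | ∃ s ∈ LinearMap.ker F, π s = p}
        zero_mem' := ⟨0, Submodule.zero_mem _, map_zero _⟩
        add_mem' := by
          rintro _ _ ⟨a, ha, rfl⟩ ⟨b, hb, rfl⟩
          exact ⟨a + b, Submodule.add_mem _ ha hb, map_add _ _ _⟩
        smul_mem' := by
          rintro c _ ⟨a, ha, rfl⟩
          refine ⟨a * thetaPoly φ θ c, Submodule.smul_mem _ (op (thetaPoly φ θ c)) ha, ?_⟩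
          rw [map_mul, hπτ, smul_eq_mul, mul_comm] }
    have hJ' : J' ≠ ⊤ := by
      intro h
      rw [Ideal.eq_top_iff_one] at h
      obtain ⟨s, hs, hs1⟩ := h
      have h1 : 1 - s ∈ LinearMap.ker F :=
        hXmul _ hXF _ (by rw [map_sub, hs1, map_one, sub_self])
      have h2 := Submodule.add_mem _ h1 hs
      rw [sub_add_cancel, LinearMap.mem_ker, hF, op_one, one_smul] at h2
      exact hv h2
    obtain ⟨m, hm, hJm⟩ := Ideal.exists_le_maximal J' hJ'
    obtain ⟨g, hg⟩ := (IsPrincipalIdealRing.principal m).principal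
    replace hg : m = Ideal.span {g} := hg
    have hg0 : g ≠ 0 := by
      rintro rfl
      refine Ring.ne_bot_of_isMaximal_of_not_isField hm (Polynomial.not_isField k) ?_
      rw [hg]; simp
    have hgi : Irreducible g :=
      ((Ideal.span_singleton_prime hg0).mp (hg ▸ hm.isPrime)).irreducible
    have hgn : Associated g (normalize g) := (normalize_associated g).symm
    have hpi : Irreducible (normalize g) := hgn.irreducible hgi
    refine ⟨normalize g, Polynomial.monic_normalize hg0, hpi, ?_⟩
    have hle : LinearMap.ker F ≤ rSpan S (φ X) ⊔ rSpan S (thetaPoly φ θ (normalize g)) := by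
      intro s hs
      rw [hmem, ← hgn.dvd_iff_dvd_left, ← Ideal.mem_span_singleton, ← hg]
      exact hJm ⟨s, hs, rfl⟩
    have heq := (hco.le_iff.mp hle).resolve_left (hcoatom _ hpi).1
    exact ⟨e.symm.trans (Submodule.quotEquivOfEq _ _ heq.symm)⟩
  · intro p q hp hpi hq hqi
    constructor
    · rintro ⟨e⟩
      have h1 : ∀ m, op (thetaPoly φ θ p) • m = (0 : rQuot2 S (φ X) (thetaPoly φ θ q)) := by
        intro m
        obtain ⟨x, rfl⟩ := e.surjective m
        rw [← map_smul, hact p _ (by rw [hπτ]) x, map_zero]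
      have h2 := h1 (Submodule.Quotient.mk 1)
      rw [← Submodule.Quotient.mk_smul, Submodule.Quotient.mk_eq_zero, hmem,
        op_smul_eq_mul, one_mul, hπτ] at h2
      exact Polynomial.eq_of_monic_of_associated hp hq (hqi.associated_of_dvd hpi h2).symm
    · rintro rfl
      exact ⟨LinearEquiv.refl _ _⟩
end

section
/- Let M be a finitely generated 1-critical right S-module which is unfaithful. Then M ≅ S/XS or M ≅ S/θS. -/
open MulOpposite

universe u

lemma aux_art_transfer {A A' M M' : Type*} [Ring A] [Ring A'] [AddCommGroup M] [Module A M]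
    [AddCommGroup M'] [Module A' M'] (f : M →+ M') (hf : Function.Surjective f)
    (N : Submodule A M) (hN : ∀ m ∈ N, f m = 0)
    (hc : ∀ (W : Submodule A' M') (a : A) (m : M), f m ∈ W → f (a • m) ∈ W)
    (h : IsArtinian A (M ⧸ N)) : IsArtinian A' M' := by
  let G : Submodule A' M' → Submodule A M := fun W =>
    { carrier := {m | f m ∈ W}
      add_mem' := by
        intro a b ha hb
        simp only [Set.mem_ofPred_eq, map_add] at *
        exact W.add_mem ha hb
      zero_mem' := by simp
      smul_mem' := fun a m hm => hc W a m hm }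
  have hG : ∀ W m, m ∈ G W ↔ f m ∈ W := fun W m => Iff.rfl
  have hmono : StrictMono (fun W : Submodule A' M' => (G W).map N.mkQ) := by
    apply Monotone.strictMono_of_injective
    · intro W W' hW
      apply Submodule.map_mono
      intro m hm
      exact hW hm
    · intro W W' hW
      have h2 : ∀ V, ((G V).map N.mkQ).comap N.mkQ = G V := by
        intro V
        rw [Submodule.comap_map_mkQ]
        apply sup_eq_right.2
        intro m hm
        rw [hG, hN m hm]
        exact V.zero_mem
      have h3 : G W = G W' := by
        rw [← h2 W, ← h2 W']
        exact congrArg _ hW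
      ext y
      obtain ⟨m, rfl⟩ := hf y
      rw [← hG, ← hG, h3]
  have : WellFoundedLT (Submodule A (M ⧸ N)) := h
  exact hmono.wellFoundedLT

lemma aux_crit_of_sub {A M : Type u} [Ring A] [AddCommGroup M] [Module A M]
    (hcrit : IsOneCritical A M) (N : Submodule A M) (hN : N ≠ ⊥) : ¬ IsArtinian A N := by
  intro h
  have := hcrit.2.2 N hN
  exact hcrit.2.1 ((isArtinian_iff_submodule_quotient N).2 ⟨h, this⟩)

lemma aux_normal {A M : Type u} [Ring A] [AddCommGroup M] [Module A M]
    (hcrit : IsOneCritical A M) (z : A) (h1 : ∀ a, ∃ a', a * z = z * a')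
    (h2 : ∀ a, ∃ a', z * a = a' * z) (m₀ : M) (hm₀ : m₀ ≠ 0) (hz : z • m₀ = 0) (m : M) :
    z • m = 0 := by
  let N : Submodule A M :=
    { carrier := {m | z • m = 0}
      add_mem' := by
        intro a b ha hb
        simp only [Set.mem_ofPred_eq, smul_add] at *
        rw [ha, hb, add_zero]
      zero_mem' := by simp
      smul_mem' := by
        intro a m hm
        obtain ⟨a', ha'⟩ := h2 a
        simp only [Set.mem_ofPred_eq] at *
        rw [smul_smul, ha', mul_smul, hm, smul_zero] }
  let I : Submodule A M :=
    { carrier := {y | ∃ m, z • m = y}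
      add_mem' := by
        rintro _ _ ⟨a, rfl⟩ ⟨b, rfl⟩
        exact ⟨a + b, smul_add _ _ _⟩
      zero_mem' := ⟨0, smul_zero _⟩
      smul_mem' := by
        rintro a _ ⟨m, rfl⟩
        obtain ⟨a', ha'⟩ := h1 a
        exact ⟨a' • m, by rw [smul_smul, smul_smul, ha']⟩ }
  have hN : N ≠ ⊥ := fun h => hm₀ ((Submodule.mem_bot A).1 (h ▸ (show m₀ ∈ N from hz)))
  have hI : I = ⊥ := by
    by_contra hI
    refine aux_crit_of_sub hcrit I hI ?_
    let f : M →+ I :=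
      { toFun := fun m => ⟨z • m, m, rfl⟩
        map_zero' := Subtype.ext (smul_zero _)
        map_add' := fun a b => Subtype.ext (smul_add _ _ _) }
    refine aux_art_transfer f ?_ N ?_ ?_ (hcrit.2.2 N hN)
    · rintro ⟨_, m, rfl⟩
      exact ⟨m, rfl⟩
    · intro m hm
      exact Subtype.ext hm
    · intro W a m hm
      obtain ⟨a', ha'⟩ := h2 a
      have : f (a • m) = a' • f m := Subtype.ext (by
        show z • a • m = a' • z • m
        rw [smul_smul, smul_smul, ha'])
      rw [this]
      exact W.smul_mem _ hm
  exact (Submodule.mem_bot A).1 (hI ▸ (show z • m ∈ I from ⟨m, rfl⟩))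

lemma aux_pid {A B M Q : Type u} [Ring A] [CommRing B] [IsDomain B] [IsPrincipalIdealRing B]
    [AddCommGroup M] [Module A M] [AddCommGroup Q] [Module A Q] (ρ : B →+* A)
    (hfg : Module.Finite A M) (hcrit : IsOneCritical A M) (q : Q)
    (hgen : ∀ y : Q, ∃ a : A, a • q = y)
    (hq : ∀ a : A, a • q = 0 → ∀ m : M, a • m = 0)
    (hdec : ∀ a : A, ∃ b : B, a • q = ρ b • q)
    (hinj : ∀ b : B, ρ b • q = 0 → b = 0) : Nonempty (M ≃ₗ[A] Q) := by
  letI : Module B M := Module.compHom M ρ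
  have hB : ∀ (b : B) (m : M), b • m = ρ b • m := fun b m => rfl
  have hAB : ∀ a : A, ∃ b : B, ∀ m : M, a • m = b • m := by
    intro a
    obtain ⟨b, hb⟩ := hdec a
    refine ⟨b, fun m => ?_⟩
    have := hq (a - ρ b) (by rw [sub_smul, hb, sub_self]) m
    rw [sub_smul, sub_eq_zero] at this
    exact this
  have hfin : Module.Finite B M := by
    obtain ⟨s, hs⟩ := hfg.fg_top
    refine ⟨⟨s, ?_⟩⟩
    rw [eq_top_iff]
    intro m _
    have hm : m ∈ Submodule.span A (s : Set M) := hs ▸ Submodule.mem_top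
    induction hm using Submodule.span_induction with
    | mem x hx => exact Submodule.subset_span hx
    | zero => exact Submodule.zero_mem _
    | add x y _ _ hx hy => exact Submodule.add_mem _ (hx trivial) (hy trivial)
    | smul a x _ hx =>
      obtain ⟨b, hb⟩ := hAB a
      rw [hb]
      exact Submodule.smul_mem _ _ (hx trivial)
  have htf : ∀ (b : B) (m : M), b • m = 0 → b = 0 ∨ m = 0 := by
    intro b m hbm
    by_contra! hcon
    obtain ⟨hb, hm⟩ := hcon
    have hmem : m ∈ Submodule.span A {m} := Submodule.mem_span_singleton_self m
    refine aux_crit_of_sub hcrit (Submodule.span A {m}) (by simpa using hm) ?_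
    let f : B →+ Submodule.span A {m} :=
      { toFun := fun b => ⟨b • m, by rw [hB]; exact Submodule.smul_mem _ _ hmem⟩
        map_zero' := Subtype.ext (zero_smul _ _)
        map_add' := fun a b => Subtype.ext (add_smul _ _ _) }
    refine aux_art_transfer f ?_ (Ideal.span {b}) ?_ ?_ ?_
    · rintro ⟨y, hy⟩
      obtain ⟨a, rfl⟩ := Submodule.mem_span_singleton.1 hy
      obtain ⟨b, hb⟩ := hAB a
      exact ⟨b, Subtype.ext (hb m).symm⟩
    · intro c hc
      obtain ⟨d, rfl⟩ := Ideal.mem_span_singleton'.1 hc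
      refine Subtype.ext ?_
      show (d * b) • m = 0
      rw [mul_smul, hbm, smul_zero]
    · intro W c d hd
      have : f (c • d) = ρ c • f d := Subtype.ext (by
        show (c * d) • m = ρ c • d • m
        rw [mul_smul, hB c])
      rw [this]
      exact W.smul_mem _ hd
    · exact (isFiniteLength_iff_isNoetherian_isArtinian.1
        (isFiniteLength_quotient_span_singleton B (mem_nonZeroDivisors_of_ne_zero hb))).2
  have htf' : Module.IsTorsionFree B M := by
    refine ⟨fun b hb m₁ m₂ h => ?_⟩
    have h' : b • m₁ = b • m₂ := h
    rcases htf b (m₁ - m₂) (by rw [smul_sub, h', sub_self]) with h1 | h1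
    · exact absurd h1 hb.ne_zero
    · exact sub_eq_zero.1 h1
  have hArt : ¬ IsArtinian B B := by
    intro h
    have : IsArtinianRing B := h
    have : IsArtinian B M := inferInstance
    refine hcrit.2.1 (aux_art_transfer (A := B) (AddMonoidHom.id M) (fun x => ⟨x, rfl⟩)
      ⊥ (fun m hm => by simpa using hm) ?_ inferInstance)
    intro W b m hm
    exact W.smul_mem (ρ b) hm
  have hfree : Module.Free B M := inferInstance
  let e := Module.Free.chooseBasis B M
  have hne : Nontrivial M := by
    by_contra h
    rw [not_nontrivial_iff_subsingleton] at h
    exact hcrit.2.1 inferInstance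
  have hsub : Subsingleton (Module.Free.ChooseBasisIndex B M) := by
    refine ⟨fun i j => ?_⟩
    by_contra hij
    apply hArt
    have he : e i ≠ 0 := e.ne_zero i
    refine aux_art_transfer (e.coord j).toAddMonoidHom ?_ (Submodule.span A {e i}) ?_ ?_
      (hcrit.2.2 _ (by simpa using he))
    · intro b
      exact ⟨b • e j, by simp⟩
    · intro m hm
      obtain ⟨a, rfl⟩ := Submodule.mem_span_singleton.1 hm
      obtain ⟨b, hb⟩ := hAB a
      rw [hb]
      simp [Finsupp.single_apply, hij]
    · intro W a m hm
      obtain ⟨b, hb⟩ := hAB a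
      rw [hb]
      have : (e.coord j).toAddMonoidHom (b • m) = b • (e.coord j).toAddMonoidHom m := by
        simp
      rw [this]
      exact W.smul_mem _ hm
  obtain ⟨i⟩ : Nonempty (Module.Free.ChooseBasisIndex B M) := e.index_nonempty
  have hspan : ∀ m : M, ∃ b : B, b • e i = m := by
    intro m
    have : Unique (Module.Free.ChooseBasisIndex B M) := ⟨⟨i⟩, fun j => Subsingleton.elim _ _⟩
    refine ⟨e.repr m i, ?_⟩
    have h := e.sum_repr m
    rw [Fintype.sum_eq_single i (fun j hj => absurd (Subsingleton.elim j i) hj)] at h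
    exact h
  have hker : LinearMap.ker (LinearMap.toSpanSingleton A M (e i)) =
      LinearMap.ker (LinearMap.toSpanSingleton A Q q) := by
    ext a
    simp only [LinearMap.mem_ker, LinearMap.toSpanSingleton_apply]
    refine ⟨fun h => ?_, fun h => hq a h _⟩
    obtain ⟨b, hb⟩ := hdec a
    have h3 := hq (a - ρ b) (by rw [sub_smul, hb, sub_self]) (e i)
    rw [sub_smul, h, zero_sub, neg_eq_zero] at h3
    rcases htf b (e i) h3 with h4 | h4
    · rw [hb, h4, map_zero, zero_smul]
    · exact absurd h4 (e.ne_zero i)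
  have hs1 : Function.Surjective (LinearMap.toSpanSingleton A M (e i)) := by
    intro m
    obtain ⟨b, hb⟩ := hspan m
    exact ⟨ρ b, hb⟩
  have hs2 : Function.Surjective (LinearMap.toSpanSingleton A Q q) := by
    intro y
    obtain ⟨a, ha⟩ := hgen y
    exact ⟨a, ha⟩
  exact ⟨((LinearMap.quotKerEquivOfSurjective _ hs1).symm.trans
    (Submodule.quotEquivOfEq _ _ hker)).trans (LinearMap.quotKerEquivOfSurjective _ hs2)⟩

section skew

variable {R S : Type u} [CommRing R] [Ring S] {α : R ≃+* R} {φ : R →+* S} {θ : S}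

lemma aux_ind (hS : IsSkewPolynomialRing α φ θ) (P : S → Prop) (hφ : ∀ r, P (φ r)) (hθ : P θ)
    (hadd : ∀ a b, P a → P b → P (a + b)) (hmul : ∀ a b, P a → P b → P (a * b)) (s : S) :
    P s := by
  obtain ⟨p, rfl⟩ := hS.bijective.2 s
  have hpow : ∀ n : ℕ, P (θ ^ n) := by
    intro n
    induction n with
    | zero => simpa using hφ 1
    | succ n ih => rw [pow_succ]; exact hmul _ _ ih hθ
  show P (∑ n ∈ p.support, φ (p n) * θ ^ n)
  have h0 : P 0 := by simpa using hφ 0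
  induction p.support using Finset.induction_on with
  | empty => simpa using h0
  | insert a s ha ih =>
    rw [Finset.sum_insert ha]
    exact hadd _ _ (hmul _ _ (hφ _) (hpow _)) ih

lemma aux_theta_right (hS : IsSkewPolynomialRing α φ θ) (r : R) :
    φ r * θ = θ * φ (α.symm r) := by
  rw [hS.commutes]; simp

lemma aux_theta1 (hS : IsSkewPolynomialRing α φ θ) (s : S) : ∃ s', s * θ = θ * s' := by
  refine aux_ind hS (fun s => ∃ s', s * θ = θ * s') (fun r => ⟨_, aux_theta_right hS r⟩) ⟨θ, rfl⟩ ?_ ?_ s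
  · rintro a b ⟨a', ha⟩ ⟨b', hb⟩
    exact ⟨a' + b', by rw [add_mul, ha, hb, mul_add]⟩
  · rintro a b ⟨a', ha⟩ ⟨b', hb⟩
    exact ⟨a' * b', by rw [mul_assoc, hb, ← mul_assoc, ha, mul_assoc]⟩

lemma aux_theta2 (hS : IsSkewPolynomialRing α φ θ) (s : S) : ∃ s', θ * s = s' * θ := by
  refine aux_ind hS (fun s => ∃ s', θ * s = s' * θ) (fun r => ⟨_, hS.commutes r⟩) ⟨θ, rfl⟩ ?_ ?_ s
  · rintro a b ⟨a', ha⟩ ⟨b', hb⟩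
    exact ⟨a' + b', by rw [mul_add, ha, hb, add_mul]⟩
  · rintro a b ⟨a', ha⟩ ⟨b', hb⟩
    exact ⟨a' * b', by rw [← mul_assoc, ha, mul_assoc, hb, mul_assoc]⟩

lemma aux_X1 (hS : IsSkewPolynomialRing α φ θ) (X : R) (hα : X ∣ α X) (s : S) :
    ∃ s', s * φ X = φ X * s' := by
  refine aux_ind hS (fun s => ∃ s', s * φ X = φ X * s') (fun r => ⟨φ r, by rw [← map_mul, mul_comm, map_mul]⟩) ?_ ?_ ?_ s
  · obtain ⟨u, hu⟩ := hα
    exact ⟨φ u * θ, by rw [hS.commutes, hu, map_mul, mul_assoc]⟩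
  · rintro a b ⟨a', ha⟩ ⟨b', hb⟩
    exact ⟨a' + b', by rw [add_mul, ha, hb, mul_add]⟩
  · rintro a b ⟨a', ha⟩ ⟨b', hb⟩
    exact ⟨a' * b', by rw [mul_assoc, hb, ← mul_assoc, ha, mul_assoc]⟩

lemma aux_X2 (hS : IsSkewPolynomialRing α φ θ) (X : R) (hα : X ∣ α.symm X) (s : S) :
    ∃ s', φ X * s = s' * φ X := by
  refine aux_ind hS (fun s => ∃ s', φ X * s = s' * φ X) (fun r => ⟨φ r, by rw [← map_mul, mul_comm, map_mul]⟩) ?_ ?_ ?_ s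
  · obtain ⟨u, hu⟩ := hα
    exact ⟨θ * φ u, by rw [aux_theta_right hS, hu, mul_comm, map_mul, mul_assoc]⟩
  · rintro a b ⟨a', ha⟩ ⟨b', hb⟩
    exact ⟨a' + b', by rw [mul_add, ha, hb, add_mul]⟩
  · rintro a b ⟨a', ha⟩ ⟨b', hb⟩
    exact ⟨a' * b', by rw [← mul_assoc, ha, mul_assoc, hb, mul_assoc]⟩

lemma aux_dec_theta (hS : IsSkewPolynomialRing α φ θ) (s : S) :
    ∃ r s', s = φ r + θ * s' := by
  refine aux_ind hS (fun s => ∃ r s', s = φ r + θ * s') (fun r => ⟨r, 0, by simp⟩) ⟨0, 1, by simp⟩ ?_ ?_ s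
  · rintro _ _ ⟨r, a, rfl⟩ ⟨t, b, rfl⟩
    exact ⟨r + t, a + b, by rw [map_add, mul_add]; abel⟩
  · rintro _ _ ⟨r, a, rfl⟩ ⟨t, b, rfl⟩
    refine ⟨r * t, a * (φ t + θ * b) + φ (α.symm r) * b, ?_⟩
    rw [add_mul, mul_add (φ r), ← mul_assoc (φ r), aux_theta_right hS, map_mul]
    noncomm_ring

lemma aux_inj_theta (hS : IsSkewPolynomialRing α φ θ) (r : R) (s : S) (h : φ r = θ * s) :
    r = 0 := by
  obtain ⟨p, rfl⟩ := hS.bijective.2 s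
  let p' : ℕ →₀ R := (p.mapRange α (map_zero α)).mapDomain Nat.succ
  have h1 : (p'.sum fun n r => φ r * θ ^ n) = θ * (p.sum fun n r => φ r * θ ^ n) := by
    rw [Finsupp.sum_mapDomain_index (by simp) (by intros; simp [add_mul]),
      Finsupp.sum_mapRange_index (by simp), Finsupp.mul_sum]
    refine Finsupp.sum_congr fun n _ => ?_
    rw [← mul_assoc, hS.commutes, pow_succ', mul_assoc]
  have h2 : ((Finsupp.single 0 r : ℕ →₀ R).sum fun n r => φ r * θ ^ n) = φ r := by
    simp
  have h3 : Finsupp.single 0 r = p' := hS.bijective.1 (h2.trans (h.trans h1.symm))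
  have h4 := DFunLike.congr_fun h3 0
  have h5 : p' 0 = 0 := Finsupp.mapDomain_of_notMem_range _ _ (by simp)
  rwa [h5, Finsupp.single_eq_same] at h4

lemma aux_mono [IsDomain R] (hS : IsSkewPolynomialRing α φ θ)
    (hord : ∀ n : ℕ, 0 < n → ∃ a, (α ^ n) a ≠ a)
    (I : Set S) (hsub : ∀ a ∈ I, ∀ b ∈ I, a - b ∈ I) (hl : ∀ a, ∀ b ∈ I, a * b ∈ I)
    (hr : ∀ a, ∀ b ∈ I, b * a ∈ I) (s : S) (hs : s ≠ 0) (hsI : s ∈ I) :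
    ∃ (r : R) (n : ℕ), r ≠ 0 ∧ φ r * θ ^ n ∈ I := by
  have hpow : ∀ (n : ℕ) (a : R), θ ^ n * φ a = φ ((α ^ n) a) * θ ^ n := by
    intro n
    induction n with
    | zero => intro a; simp
    | succ n ih =>
      intro a
      rw [pow_succ, mul_assoc, hS.commutes, ← mul_assoc, ih, mul_assoc, pow_succ α]
      rfl
  have main : ∀ (N : ℕ) (p : ℕ →₀ R), p.support.card = N → p ≠ 0 →
      (∑ n ∈ p.support, φ (p n) * θ ^ n) ∈ I →
      ∃ (r : R) (n : ℕ), r ≠ 0 ∧ φ r * θ ^ n ∈ I := by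
    intro N
    induction N using Nat.strong_induction_on with
    | _ N ih =>
      intro p hN hp hpI
      obtain ⟨i, hi⟩ := Finsupp.support_nonempty_iff.2 hp
      by_cases hex : ∃ i ∈ p.support, ∃ j ∈ p.support, i < j
      · obtain ⟨i, hi, j, hj, hij⟩ := hex
        obtain ⟨a, ha⟩ := hord (j - i) (by omega)
        have ha' : (α ^ i) a - (α ^ j) a ≠ 0 := by
          intro h
          rw [sub_eq_zero] at h
          apply ha
          apply (α ^ i).injective
          rw [h, ← RingAut.mul_apply, ← pow_add]
          congr 2
          omega
        let p' : ℕ →₀ R := Finsupp.onFinset p.support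
          (fun n => p n * ((α ^ n) a - (α ^ j) a)) (by
            intro n hn
            rw [Finsupp.mem_support_iff]
            exact left_ne_zero_of_mul hn)
        have hp' : ∀ n, p' n = p n * ((α ^ n) a - (α ^ j) a) := fun n => rfl
        have hsup : p'.support ⊆ p.support := Finsupp.support_onFinset_subset
        refine ih p'.support.card ?_ p' rfl ?_ ?_
        · rw [← hN]
          refine Finset.card_lt_card ⟨hsup, fun h => ?_⟩
          have := h hj
          rw [Finsupp.mem_support_iff, hp', sub_self, mul_zero] at this
          exact this rfl
        · intro h
          have := DFunLike.congr_fun h i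
          rw [hp'] at this
          exact mul_ne_zero (Finsupp.mem_support_iff.1 hi) ha' this
        · rw [Finset.sum_subset hsup (by
            intro n _ hn
            rw [Finsupp.notMem_support_iff.1 hn, map_zero, zero_mul])]
          have key := hsub _ (hr (φ a) _ hpI) _ (hl (φ ((α ^ j) a)) _ hpI)
          convert key using 1
          rw [Finset.sum_mul, Finset.mul_sum, ← Finset.sum_sub_distrib]
          refine Finset.sum_congr rfl fun n _ => ?_
          rw [mul_assoc, hpow, ← mul_assoc, ← mul_assoc, ← map_mul, ← map_mul, ← sub_mul,
            ← map_sub, hp']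
          congr 2
          ring
      · push Not at hex
        have hsingle : p.support = {i} := by
          ext j
          rw [Finset.mem_singleton]
          refine ⟨fun hj => le_antisymm (hex i hi j hj) (hex j hj i hi), ?_⟩
          rintro rfl
          exact hi
        refine ⟨p i, i, Finsupp.mem_support_iff.1 hi, ?_⟩
        rwa [hsingle, Finset.sum_singleton] at hpI
  obtain ⟨p, rfl⟩ := hS.bijective.2 s
  refine main _ p rfl ?_ hsI
  rintro rfl
  exact hs (by simp)

end skew

lemma aux_rquot {S : Type u} [Ring S] (z s : S) :
    op s • (Submodule.Quotient.mk 1 : rQuot S z) = 0 ↔ ∃ y, s = z * y := by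
  rw [← Submodule.Quotient.mk_smul, Submodule.Quotient.mk_eq_zero]
  simp only [op_smul_eq_mul, one_mul]
  rw [rSpan, Submodule.mem_span_singleton]
  constructor
  · rintro ⟨a, ha⟩
    exact ⟨a.unop, ha.symm⟩
  · rintro ⟨y, hy⟩
    exact ⟨op y, hy.symm⟩

/-- Let `M` be a finitely generated 1-critical right `S`-module which
is unfaithful.  Then `M ≅ S/XS` or `M ≅ S/θS`. -/
theorem unfaithful_one_critical_classification
    {k : Type u} [Field k]
    {R : Type u} [CommRing R] [IsDomain R] [IsDiscreteValuationRing R] [Algebra k R]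
    (X : R) (hX : IsLocalRing.maximalIdeal R = Ideal.span {X})
    (hres : Function.Bijective ((IsLocalRing.residue R).comp (algebraMap k R)))
    (α : R ≃ₐ[k] R) (hord : ∀ n : ℕ, 0 < n → α ^ n ≠ 1)
    {S : Type u} [Ring S] (φ : R →+* S) (θ : S)
    (hS : IsSkewPolynomialRing α.toRingEquiv φ θ)
    {T : Type u} [Ring T] (ψ : S →+* T) (hT : IsLocalizationAt (φ X) ψ)
    (M : Type u) [AddCommGroup M] [Module Sᵐᵒᵖ M] (hfg : Module.Finite Sᵐᵒᵖ M)
    (hcrit : IsOneCritical Sᵐᵒᵖ M) (hunf : ¬ FaithfulSMul Sᵐᵒᵖ M) :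
    Nonempty (M ≃ₗ[Sᵐᵒᵖ] rQuot S (φ X)) ∨ Nonempty (M ≃ₗ[Sᵐᵒᵖ] rQuot S θ) := by
  classical
  have hXd : ∀ (β : R ≃ₐ[k] R), X ∣ β X := by
    intro β
    have h1 : X ∈ IsLocalRing.maximalIdeal R := hX ▸ Ideal.mem_span_singleton_self X
    have h2 : β X ∈ IsLocalRing.maximalIdeal R := by
      rw [IsLocalRing.mem_maximalIdeal, mem_nonunits_iff] at *
      intro h
      apply h1
      simpa using h.map β.symm
    rw [hX, Ideal.mem_span_singleton] at h2
    exact h2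
  have hM : ∃ m : M, m ≠ 0 := by
    by_contra! h
    have : Subsingleton M := ⟨fun a b => by rw [h a, h b]⟩
    exact hcrit.2.1 inferInstance
  -- a monomial annihilating `M`
  obtain ⟨r, i, hr0, hri⟩ : ∃ (r : R) (n : ℕ), r ≠ 0 ∧
      φ r * θ ^ n ∈ {s : S | ∀ m : M, op s • m = 0} := by
    have : ∃ s : S, s ≠ 0 ∧ ∀ m : M, op s • m = 0 := by
      by_contra! hcon
      apply hunf
      refine ⟨fun {a b} hab => ?_⟩
      by_contra hne
      obtain ⟨m, hm⟩ := hcon (a - b).unop (by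
        rw [Ne, MulOpposite.unop_eq_zero_iff, sub_eq_zero]; exact hne)
      apply hm
      rw [MulOpposite.op_unop, sub_smul, hab, sub_self]
    obtain ⟨s, hs0, hs⟩ := this
    refine aux_mono hS ?_ _ ?_ ?_ ?_ s hs0 hs
    · intro n hn
      by_contra! h
      apply hord n hn
      ext a
      have hp : ∀ (n : ℕ) (a : R), (α.toRingEquiv ^ n) a = (α ^ n) a := by
        intro n
        induction n with
        | zero => intro a; rfl
        | succ n ih =>
          intro a
          rw [pow_succ, pow_succ, RingAut.mul_apply, ih]
          rfl
      rw [← hp, h]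
      rfl
    · intro a ha b hb m
      rw [op_sub, sub_smul, ha, hb, sub_self]
    · intro a b hb m
      rw [op_mul, mul_smul, hb]
    · intro a b hb m
      rw [op_mul, mul_smul, hb, smul_zero]
  have hirr : Irreducible X := (IsDiscreteValuationRing.irreducible_iff_uniformizer X).2 hX
  obtain ⟨n, u, rfl⟩ := IsDiscreteValuationRing.eq_unit_mul_pow_irreducible hr0 hirr
  have hkill : ∀ m : M, (op θ) ^ i • (op (φ X)) ^ n • m = 0 := by
    intro m
    have h := hri (op (φ (↑u⁻¹ : R)) • m)
    rw [smul_smul, ← op_mul, ← mul_assoc, ← map_mul, ← mul_assoc, Units.inv_mul, one_mul,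
      map_pow, op_mul, op_pow, op_pow, mul_smul] at h
    exact h
  have hinjpow : ∀ (z : Sᵐᵒᵖ), (∀ m : M, z • m = 0 → m = 0) → ∀ (n : ℕ) (m : M),
      z ^ n • m = 0 → m = 0 := by
    intro z hz n
    induction n with
    | zero => intro m hm; simpa using hm
    | succ n ih =>
      intro m hm
      rw [pow_succ, mul_smul] at hm
      exact hz _ (ih _ hm)
  by_cases hXk : ∀ m : M, op (φ X) • m = 0 → m = 0
  · right
    have hθk : ∃ m : M, op θ • m = 0 ∧ m ≠ 0 := by
      by_contra! h
      obtain ⟨m, hm⟩ := hM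
      exact hm (hinjpow _ hXk n m (hinjpow _ h i _ (hkill m)))
    obtain ⟨m₀, h0, hm₀⟩ := hθk
    have hz : ∀ m : M, op θ • m = 0 := by
      refine aux_normal hcrit (op θ) ?_ ?_ m₀ hm₀ h0
      · intro a
        obtain ⟨s', hs'⟩ := aux_theta2 hS a.unop
        exact ⟨op s', MulOpposite.unop_injective hs'⟩
      · intro a
        obtain ⟨s', hs'⟩ := aux_theta1 hS a.unop
        exact ⟨op s', MulOpposite.unop_injective hs'⟩
    let ρ : R →+* Sᵐᵒᵖ := φ.toOpposite fun a b => by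
      rw [Commute, SemiconjBy, ← map_mul, mul_comm, map_mul]
    have hρ : ∀ r, ρ r = op (φ r) := fun r => rfl
    refine aux_pid ρ hfg hcrit (Submodule.Quotient.mk 1) ?_ ?_ ?_ ?_
    · intro y
      obtain ⟨s, rfl⟩ := Submodule.Quotient.mk_surjective _ y
      exact ⟨op s, by rw [← Submodule.Quotient.mk_smul, op_smul_eq_mul, one_mul]⟩
    · intro a ha m
      obtain ⟨y, hy⟩ := (aux_rquot θ a.unop).1 ha
      rw [← op_unop a, hy, op_mul, mul_smul, hz, smul_zero]
    · intro a
      obtain ⟨r, s', hs⟩ := aux_dec_theta hS a.unop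
      refine ⟨r, ?_⟩
      rw [← sub_eq_zero, ← sub_smul, hρ, ← op_unop a, ← op_sub, aux_rquot]
      exact ⟨s', by rw [hs]; abel⟩
    · intro r hr
      rw [hρ, aux_rquot] at hr
      obtain ⟨y, hy⟩ := hr
      exact aux_inj_theta hS r y hy
  · left
    push Not at hXk
    obtain ⟨m₀, h0, hm₀⟩ := hXk
    have hX1 := aux_X1 hS X (hXd α)
    have hX2 := aux_X2 hS X (hXd α.symm)
    have hz : ∀ m : M, op (φ X) • m = 0 := by
      refine aux_normal hcrit (op (φ X)) ?_ ?_ m₀ hm₀ h0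
      · intro a
        obtain ⟨s', hs'⟩ := hX2 a.unop
        exact ⟨op s', MulOpposite.unop_injective hs'⟩
      · intro a
        obtain ⟨s', hs'⟩ := hX1 a.unop
        exact ⟨op s', MulOpposite.unop_injective hs'⟩
    have hcomm : ∀ c : k, Commute (opScalars (k := k) φ c) (op θ) := by
      intro c
      apply MulOpposite.unop_injective
      show θ * φ (algebraMap k R c) = φ (algebraMap k R c) * θ
      rw [hS.commutes]
      congr 2
      exact α.commutes c
    let ρ : Polynomial k →+* Sᵐᵒᵖ := Polynomial.eval₂RingHom' (opScalars φ) (op θ) hcomm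
    have hρC : ∀ c, ρ (Polynomial.C c) = op (φ (algebraMap k R c)) := fun c =>
      Polynomial.eval₂_C _ _
    have hρX : ρ Polynomial.X = op θ := Polynomial.eval₂_X _ _
    refine aux_pid ρ hfg hcrit (Submodule.Quotient.mk 1) ?_ ?_ ?_ ?_
    · intro y
      obtain ⟨s, rfl⟩ := Submodule.Quotient.mk_surjective _ y
      exact ⟨op s, by rw [← Submodule.Quotient.mk_smul, op_smul_eq_mul, one_mul]⟩
    · intro a ha m
      obtain ⟨y, hy⟩ := (aux_rquot (φ X) a.unop).1 ha
      rw [← op_unop a, hy, op_mul, mul_smul, hz, smul_zero]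
    · intro a
      have hdec : ∀ s : S, ∃ (p : Polynomial k) (s' : S), s = (ρ p).unop + φ X * s' := by
        intro s
        refine aux_ind hS (fun s => ∃ (p : Polynomial k) (s' : S), s = (ρ p).unop + φ X * s') ?_ ?_ ?_ ?_ s
        · intro r
          obtain ⟨c, hc⟩ := hres.2 (IsLocalRing.residue R r)
          have hd : r - algebraMap k R c ∈ IsLocalRing.maximalIdeal R := by
            rw [← IsLocalRing.residue_eq_zero_iff, map_sub, ← hc]
            simp
          rw [hX, Ideal.mem_span_singleton] at hd
          obtain ⟨v, hv⟩ := hd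
          refine ⟨Polynomial.C c, φ v, ?_⟩
          rw [hρC, ← map_mul, ← hv, unop_op, ← map_add]
          congr 1
          ring
        · exact ⟨Polynomial.X, 0, by rw [hρX]; simp⟩
        · rintro _ _ ⟨p, a, rfl⟩ ⟨t, b, rfl⟩
          exact ⟨p + t, a + b, by rw [map_add, mul_add, unop_add]; abel⟩
        · rintro _ _ ⟨p, a, rfl⟩ ⟨t, b, rfl⟩
          obtain ⟨y, hy⟩ := hX1 (ρ p).unop
          refine ⟨p * t, a * ((ρ t).unop + φ X * b) + y * b, ?_⟩
          rw [add_mul, mul_add (ρ p).unop, ← mul_assoc (ρ p).unop, hy, mul_comm p t, map_mul,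
            unop_mul]
          noncomm_ring
      obtain ⟨p, s', hs⟩ := hdec a.unop
      refine ⟨p, ?_⟩
      rw [← sub_eq_zero, ← sub_smul, ← op_unop a, ← op_unop (ρ p), ← op_sub, aux_rquot]
      exact ⟨s', by rw [hs]; abel⟩
    · intro p hp
      rw [← op_unop (ρ p), aux_rquot] at hp
      obtain ⟨y, hy⟩ := hp
      obtain ⟨g, rfl⟩ := hS.bijective.2 y
      let p' : ℕ →₀ R := Finsupp.onFinset p.support (fun n => algebraMap k R (p.coeff n)) (by
        intro n hn
        rw [Polynomial.mem_support_iff]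
        intro h
        exact hn (by rw [h, map_zero]))
      let g' : ℕ →₀ R := g.mapRange (fun r => X * r) (mul_zero X)
      have h1 : (p'.sum fun n r => φ r * θ ^ n) = (ρ p).unop := by
        rw [Finsupp.onFinset_sum _ (by simp)]
        show _ = unop (Polynomial.eval₂ (opScalars φ) (op θ) p)
        rw [Polynomial.eval₂_eq_sum, Polynomial.sum, Finset.unop_sum]
        refine Finset.sum_congr rfl fun n _ => ?_
        rw [unop_mul, unop_pow, unop_op]
        have := (hcomm (p.coeff n)).pow_right n
        exact (congrArg unop this.eq.symm)
      have h2 : (g'.sum fun n r => φ r * θ ^ n) = φ X * (g.sum fun n r => φ r * θ ^ n) := by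
        rw [Finsupp.sum_mapRange_index (by simp), Finsupp.mul_sum]
        refine Finsupp.sum_congr fun n _ => ?_
        rw [map_mul, mul_assoc]
      have h3 : p' = g' := hS.bijective.1 (h1.trans (hy.trans h2.symm))
      ext n
      have h4 : algebraMap k R (p.coeff n) = X * g n := DFunLike.congr_fun h3 n
      have h5 : X ∈ IsLocalRing.maximalIdeal R := hX ▸ Ideal.mem_span_singleton_self X
      rw [Polynomial.coeff_zero]
      apply hres.1
      rw [map_zero, RingHom.comp_apply, h4, IsLocalRing.residue_eq_zero_iff]
      exact Ideal.mul_mem_right _ _ h5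
end
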